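/- arXiv:math/0512189 — 3 statements merged into one kernel-verified Lean document; each statement's English description precedes it below -/
import Mathlib

section
/- Let W and W' be Coxeter groups with the same generating set S, where the Coxeter matrix of W' is obtained from that of W by increasing some entries (i.e., m'(s,t) ≥ m(s,t) for all s,t). If a word in S* is a reduced expression in W, then it is also a reduced expression in W'. -/
namespace CoxeterMatrix

variable {B : Type*} (M : CoxeterMatrix B)

/-- The simple coroot `e_j ↦ -2 cos (π / M i j)` of the geometric representation on `B →₀ ℝ`.
An entry `M i j = 0`, standing for `∞`, yields the value `-2`. -/
noncomputable def simpleCoroot (i : B) : Module.Dual ℝ (B →₀ ℝ) :=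
  Finsupp.linearCombination ℝ fun j ↦ -2 * Real.cos (Real.pi / M i j)

theorem simpleCoroot_single (i j : B) :
    M.simpleCoroot i (Finsupp.single j 1) = -2 * Real.cos (Real.pi / M i j) := by
  simp [simpleCoroot]

theorem simpleCoroot_single_self (i : B) : M.simpleCoroot i (Finsupp.single i 1) = 2 := by
  simp [simpleCoroot_single]

/-- The simple reflections of the geometric representation on `B →₀ ℝ`. -/
noncomputable def simpleReflection (i : B) : (B →₀ ℝ) ≃ₗ[ℝ] (B →₀ ℝ) :=
  Module.reflection (M.simpleCoroot_single_self i)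

theorem simpleCoroot_mul_simpleCoroot (i j : B) :
    2 * Real.cos (2 * (Real.pi / M i j)) =
      M.simpleCoroot i (Finsupp.single j 1) * M.simpleCoroot j (Finsupp.single i 1) - 2 := by
  rw [simpleCoroot_single, simpleCoroot_single, M.symmetric j i, Real.cos_two_mul]
  ring

theorem sin_two_mul_pi_div_pos {m : ℕ} (hm : 2 < m) : 0 < Real.sin (2 * (Real.pi / m)) := by
  have hm' : (2 : ℝ) < m := by exact_mod_cast hm
  apply Real.sin_pos_of_pos_of_lt_pi
  · have := Real.pi_pos
    positivity
  · rw [← mul_div_assoc, div_lt_iff₀ (by linarith)]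
    nlinarith [Real.pi_pos]

theorem simpleReflection_mul_pow_eq_one (i j : B) :
    (M.simpleReflection i * M.simpleReflection j) ^ M i j = 1 := by
  rcases eq_or_ne i j with rfl | hij
  · rw [M.diagonal, pow_one]
    ext1 v
    rw [LinearEquiv.mul_apply]
    exact Module.involutive_reflection (M.simpleCoroot_single_self i) v
  ext1 v
  have h := Module.reflection_mul_reflection_pow_apply (M.simpleCoroot_single_self i)
    (M.simpleCoroot_single_self j) (M i j) v _ (M.simpleCoroot_mul_simpleCoroot i j)
  have hcos := M.simpleCoroot_single j i
  have hcos' := M.simpleCoroot_single i j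
  rw [M.symmetric j i] at hcos
  have h1 := M.off_diagonal i j hij
  change M i j ≠ 1 at h1
  unfold simpleReflection
  rw [h]
  generalize M i j = m at *
  clear h
  obtain rfl | rfl | hm : m = 0 ∨ m = 2 ∨ 2 < m := by omega
  · simp
  · simp only [hcos, hcos', Nat.cast_ofNat, mul_div_cancel₀ _ (two_ne_zero' ℝ)]
    norm_num
    abel
  have hsin := sin_two_mul_pi_div_pos hm
  have hS := Polynomial.Chebyshev.S_two_mul_real_cos (2 * (Real.pi / m))
  have hm0 : (m : ℝ) ≠ 0 := by positivity
  obtain ⟨k, rfl | rfl⟩ := m.even_or_odd'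
  · have e1 : (((2 * k : ℕ) : ℤ) - 2) / 2 = k - 1 := by omega
    have e2 : (((2 * k : ℕ) : ℤ) - 1) / 2 = k - 1 := by omega
    have h0 : (Polynomial.Chebyshev.S ℝ (k - 1)).eval
        (2 * Real.cos (2 * (Real.pi / (2 * k : ℕ)))) = 0 := by
      apply (mul_eq_zero.mp ((hS (k - 1)).trans _)).resolve_right hsin.ne'
      rw [← Real.sin_pi]
      congr 1
      push_cast at hm0 ⊢
      have hk0 : (k : ℝ) ≠ 0 := right_ne_zero_of_mul hm0
      field_simp
      ring
    rw [e1, e2, h0]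
    simp
  · have e1 : (((2 * k + 1 : ℕ) : ℤ) - 2) / 2 = k - 1 := by omega
    have e2 : (((2 * k + 1 : ℕ) : ℤ) - 1) / 2 = k := by omega
    have e3 : (((2 * k + 1 : ℕ) : ℤ) - 3) / 2 = k - 1 := by omega
    have e4 : (((2 * k + 1 : ℕ) : ℤ)) / 2 = k := by omega
    have h0 : (Polynomial.Chebyshev.S ℝ k).eval
          (2 * Real.cos (2 * (Real.pi / (2 * k + 1 : ℕ)))) +
        (Polynomial.Chebyshev.S ℝ (k - 1)).eval
          (2 * Real.cos (2 * (Real.pi / (2 * k + 1 : ℕ)))) = 0 := by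
      refine (mul_eq_zero.mp ?_).resolve_right hsin.ne'
      rw [add_mul, hS, hS, add_eq_zero_iff_eq_neg, ← Real.sin_neg, ← Real.sin_add_two_pi (-_)]
      congr 1
      push_cast at hm0 ⊢
      field_simp
      ring
    rw [e1, e2, e3, e4, h0]
    simp

theorem dvd_of_simpleReflection_mul_pow_eq_one {i j : B} (hij : i ≠ j) {k : ℕ}
    (hk : (M.simpleReflection i * M.simpleReflection j) ^ k = 1) : M i j ∣ k := by
  have h := Module.reflection_mul_reflection_pow_apply_self (M.simpleCoroot_single_self i)
    (M.simpleCoroot_single_self j) k _ (M.simpleCoroot_mul_simpleCoroot i j)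
  have hcos := M.simpleCoroot_single j i
  rw [M.symmetric j i] at hcos
  have h1 := M.off_diagonal i j hij
  change M i j ≠ 1 at h1
  unfold simpleReflection at hk
  rw [hk] at h
  have hi := DFunLike.congr_fun h i
  have hj := DFunLike.congr_fun h j
  simp only [LinearEquiv.coe_one, id_eq, Finsupp.add_apply, Finsupp.smul_apply,
    Finsupp.single_eq_same, Finsupp.single_eq_of_ne hij, Finsupp.single_eq_of_ne hij.symm,
    smul_eq_mul, mul_zero, add_zero, zero_add, mul_one] at hi hj
  rw [hcos] at hj
  generalize M i j = m at *
  clear h hk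
  obtain rfl | rfl | hm : m = 0 ∨ m = 2 ∨ 2 < m := by omega
  · simp at hi
    rw [zero_dvd_iff, ← Nat.cast_eq_zero (R := ℝ)]
    linarith
  · rw [Nat.cast_ofNat, mul_div_cancel₀ _ (two_ne_zero' ℝ), Real.cos_pi, mul_neg_one,
      Polynomial.Chebyshev.S_eval_neg_two, Polynomial.Chebyshev.S_eval_neg_two] at hi
    rw [← even_iff_two_dvd]
    by_contra hodd
    have ho : Odd (k : ℤ) := by exact_mod_cast Nat.not_even_iff_odd.mp hodd
    have he : Even ((k : ℤ) - 1) := ho.sub_odd odd_one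
    rw [Int.negOnePow_odd _ ho, Int.negOnePow_even _ he] at hi
    norm_num at hi
  have hsin := sin_two_mul_pi_div_pos hm
  have hS := Polynomial.Chebyshev.S_two_mul_real_cos (2 * (Real.pi / m))
  have hm' : (2 : ℝ) < m := by exact_mod_cast hm
  have hm0 : (m : ℝ) ≠ 0 := by positivity
  have hc : 0 < Real.cos (Real.pi / m) := by
    apply Real.cos_pos_of_mem_Ioo
    have := Real.pi_pos
    constructor
    · have : 0 < Real.pi / m := by positivity
      linarith
    · exact div_lt_div_of_pos_left this two_pos hm'
  have h0 : (Polynomial.Chebyshev.S ℝ (k - 1)).eval (2 * Real.cos (2 * (Real.pi / m))) = 0 := by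
    apply (mul_eq_zero.mp hj.symm).resolve_right
    linarith
  have hs := hS (k - 1)
  have hs' := hS k
  rw [h0, add_zero] at hi
  rw [← hi, one_mul, Int.cast_natCast, add_mul, one_mul, Real.sin_add] at hs'
  rw [h0, zero_mul] at hs
  push_cast at hs
  rw [sub_add_cancel] at hs
  rw [← hs, zero_mul, zero_add] at hs'
  have hone : Real.cos (k * (2 * (Real.pi / m))) = 1 :=
    mul_right_cancel₀ hsin.ne' (by linarith)
  obtain ⟨n, hn⟩ := (Real.cos_eq_one_iff _).mp hone
  field_simp at hn
  rw [← Int.natCast_dvd_natCast]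
  exact ⟨n, by rw [mul_comm]; exact_mod_cast hn.symm⟩

end CoxeterMatrix

namespace CoxeterSystem

variable {B W : Type*} [Group W] {M : CoxeterMatrix B} (cs : CoxeterSystem M W)

/-- In a Coxeter group, the order of `s i * s j` is a multiple of `M i j`. -/
theorem dvd_of_simple_mul_simple_pow_eq_one {i j : B} (hij : i ≠ j) {k : ℕ}
    (hk : (cs.simple i * cs.simple j) ^ k = 1) : M i j ∣ k := by
  apply M.dvd_of_simpleReflection_mul_pow_eq_one hij
  have hlift : M.IsLiftable M.simpleReflection := M.simpleReflection_mul_pow_eq_one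
  have h := congrArg (cs.lift ⟨_, hlift⟩) hk
  rwa [map_pow, map_mul, map_one, cs.lift_apply_simple hlift, cs.lift_apply_simple hlift] at h

theorem prod_map_reverse_alternatingWord {G : Type*} [Monoid G] (f : B → G) (i j : B) (p : ℕ) :
    ((alternatingWord j i (2 * p)).reverse.map f).prod = (f i * f j) ^ p := by
  induction p with
  | zero => simp [alternatingWord]
  | succ p ih =>
    rw [show 2 * (p + 1) = 2 * p + 1 + 1 by ring, alternatingWord_succ, alternatingWord_succ]
    simp only [List.concat_eq_append, List.reverse_append, List.reverse_cons, List.reverse_nil,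
      List.nil_append, List.cons_append, List.map_cons, List.prod_cons, ih, pow_succ', mul_assoc]

open Classical in
theorem even_count_leftInvSeq_alternatingWord (i j : B) (t : W) :
    Even ((cs.leftInvSeq (alternatingWord i j (2 * M i j))).count t) := by
  have hdrop : (cs.leftInvSeq (alternatingWord i j (2 * M i j))).drop (M i j) =
      (cs.leftInvSeq (alternatingWord i j (2 * M i j))).take (M i j) := by
    apply List.ext_getElem
    · simp
      omega
    intro k h1 h2
    simp only [List.length_take, length_leftInvSeq, length_alternatingWord] at h2
    rw [List.getElem_drop, List.getElem_take,
      getElem_leftInvSeq_alternatingWord cs i j _ _ (by omega),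
      getElem_leftInvSeq_alternatingWord cs i j _ _ (by omega),
      prod_alternatingWord_eq_mul_pow, prod_alternatingWord_eq_mul_pow,
      show (2 * (M i j + k) + 1) / 2 = M i j + k by omega, show (2 * k + 1) / 2 = k by omega,
      pow_add, simple_mul_simple_pow', one_mul]
    simp
  rw [← List.take_append_drop (M i j) (cs.leftInvSeq (alternatingWord i j (2 * M i j))),
    hdrop, List.count_append]
  exact Even.add_self _

open Classical in
/-- The action of a simple reflection on `W × ZMod 2`, conjugating the first component and
changing the second component exactly when the first is that simple reflection. -/
noncomputable def inversionPerm (i : B) : Equiv.Perm (W × ZMod 2) :=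
  Function.Involutive.toPerm
    (fun p ↦ (cs.simple i * p.1 * cs.simple i, p.2 + if p.1 = cs.simple i then 1 else 0)) <| by
      rintro ⟨t, e⟩
      have h : cs.simple i * t * cs.simple i = cs.simple i ↔ t = cs.simple i := by
        rw [mul_eq_right, mul_eq_one_iff_inv_eq, inv_simple, eq_comm]
      ext
      · simp [mul_assoc]
      · simp only [h]
        split_ifs <;> simp [add_assoc, CharTwo.add_self_eq_zero]

open Classical in
theorem inversionPerm_apply (i : B) (t : W) (e : ZMod 2) :
    cs.inversionPerm i (t, e) =
      (cs.simple i * t * cs.simple i, e + if t = cs.simple i then 1 else 0) :=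
  rfl

open Classical in
theorem prod_map_inversionPerm_apply (ω : List B) (t : W) (e : ZMod 2) :
    (ω.map cs.inversionPerm).prod (t, e) =
      (cs.wordProd ω * t * (cs.wordProd ω)⁻¹, e + (cs.rightInvSeq ω).count t) := by
  induction ω with
  | nil => simp
  | cons i ω ih =>
    rw [List.map_cons, List.prod_cons, Equiv.Perm.mul_apply, ih, rightInvSeq, List.count_cons,
      wordProd_cons]
    have h : cs.wordProd ω * t * (cs.wordProd ω)⁻¹ = cs.simple i ↔
        (cs.wordProd ω)⁻¹ * cs.simple i * cs.wordProd ω = t := by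
      rw [mul_inv_eq_iff_eq_mul, ← eq_inv_mul_iff_mul_eq, eq_comm, mul_assoc]
    simp only [inversionPerm_apply, h, beq_iff_eq]
    ext
    · simp [mul_assoc]
    · push_cast
      simp [add_assoc]

theorem isLiftable_inversionPerm : M.IsLiftable cs.inversionPerm := by
  classical
  intro i j
  ext1 ⟨t, e⟩
  rw [← prod_map_reverse_alternatingWord, prod_map_inversionPerm_apply, rightInvSeq_reverse,
    List.count_reverse, wordProd, prod_map_reverse_alternatingWord, simple_mul_simple_pow,
    M.symmetric i j, (ZMod.natCast_eq_zero_iff_even).mpr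
      (cs.even_count_leftInvSeq_alternatingWord j i t)]
  simp

open Classical in
/-- The parity of the multiplicity of `t` in the right inversion sequence of a word depends only
on the product of the word. -/
theorem count_rightInvSeq_eq_of_wordProd_eq {ω ω' : List B} (h : cs.wordProd ω = cs.wordProd ω')
    (t : W) : ((cs.rightInvSeq ω).count t : ZMod 2) = (cs.rightInvSeq ω').count t := by
  have key (ω : List B) : cs.lift ⟨_, cs.isLiftable_inversionPerm⟩ (cs.wordProd ω) =
      (ω.map cs.inversionPerm).prod := by
    rw [wordProd, map_list_prod, List.map_map]
    congr 2
    funext i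
    exact cs.lift_apply_simple _ i
  have h' := congrArg (fun x ↦ cs.lift ⟨_, cs.isLiftable_inversionPerm⟩ x (t, 0)) h
  simp only [key, prod_map_inversionPerm_apply, zero_add, Prod.mk.injEq] at h'
  exact h'.2

theorem mem_rightInvSeq_of_wordProd_eq {ω ω' : List B} (hω : (cs.rightInvSeq ω).Nodup)
    (h : cs.wordProd ω = cs.wordProd ω') {t : W} (ht : t ∈ cs.rightInvSeq ω) :
    t ∈ cs.rightInvSeq ω' := by
  classical
  have hc := cs.count_rightInvSeq_eq_of_wordProd_eq h t
  rw [List.count_eq_one_of_mem hω ht] at hc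
  by_contra hn
  rw [List.count_eq_zero_of_not_mem hn] at hc
  simp at hc

theorem isReduced_of_nodup_rightInvSeq {ω : List B} (hω : (cs.rightInvSeq ω).Nodup) :
    cs.IsReduced ω := by
  obtain ⟨ω', hω', h⟩ := cs.exists_isReduced (cs.wordProd ω)
  apply (cs.length_wordProd_le ω).antisymm
  rw [h, hω'.eq]
  simpa using (hω.subperm fun t ht ↦ cs.mem_rightInvSeq_of_wordProd_eq hω h ht).length_le

/-- The exchange property. -/
theorem exists_wordProd_mul_simple_eq_eraseIdx {ω : List B} {i : B}
    (h : cs.IsRightDescent (cs.wordProd ω) i) :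
    ∃ k < ω.length, cs.wordProd ω * cs.simple i = cs.wordProd (ω.eraseIdx k) := by
  obtain ⟨τ, hτ, hτω⟩ := cs.exists_isReduced (cs.wordProd ω * cs.simple i)
  have hprod : cs.wordProd (τ.concat i) = cs.wordProd ω := by
    rw [wordProd_concat, ← hτω, simple_mul_simple_cancel_right]
  have hred : cs.IsReduced (τ.concat i) := by
    rw [IsReduced, hprod, ← cs.isRightDescent_iff.mp h, hτω, hτ.eq, List.length_concat]
  have hmem : cs.simple i ∈ cs.rightInvSeq ω := by
    apply cs.mem_rightInvSeq_of_wordProd_eq hred.nodup_rightInvSeq hprod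
    rw [rightInvSeq_concat, List.concat_eq_append]
    exact List.mem_append_right _ (List.mem_singleton_self _)
  obtain ⟨k, hk, hki⟩ := List.getElem_of_mem hmem
  refine ⟨k, by simpa using hk, ?_⟩
  rw [← wordProd_mul_getD_rightInvSeq, List.getD_eq_getElem _ _ hk, hki]

theorem isReduced_alternatingWord {i j : B} (hij : i ≠ j) {k : ℕ} (hk : M i j = 0 ∨ k ≤ M i j) :
    cs.IsReduced (alternatingWord i j k) := by
  have key (i j : B) (hij : i ≠ j) (hk : M i j = 0 ∨ k ≤ M i j) :
      cs.IsReduced ((alternatingWord i j (2 * (k + 1))).take k) := by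
    rw [← isReduced_reverse_iff]
    apply isReduced_of_nodup_rightInvSeq
    rw [rightInvSeq_reverse, List.nodup_reverse, leftInvSeq_take, List.Nodup,
      List.pairwise_iff_getElem]
    intro a b ha hb hab heq
    simp only [List.length_take, length_leftInvSeq, length_alternatingWord] at ha hb
    rw [List.getElem_take, List.getElem_take,
      getElem_leftInvSeq_alternatingWord cs i j _ _ (by omega),
      getElem_leftInvSeq_alternatingWord cs i j _ _ (by omega),
      prod_alternatingWord_eq_mul_pow, prod_alternatingWord_eq_mul_pow,
      show (2 * a + 1) / 2 = a by omega, show (2 * b + 1) / 2 = b by omega,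
      if_neg (by simp), if_neg (by simp), mul_right_inj,
      ← Nat.add_sub_cancel' hab.le, pow_add, left_eq_mul] at heq
    have hdvd := cs.dvd_of_simple_mul_simple_pow_eq_one hij.symm heq
    rw [M.symmetric j i] at hdvd
    rcases hk with hk | hk
    · rw [hk, zero_dvd_iff] at hdvd
      omega
    · have := Nat.le_of_dvd (by omega) hdvd
      omega
  by_cases he : Even k
  · have h := key i j hij hk
    rwa [listTake_alternatingWord i j _ _ (by omega), if_pos he] at h
  · have h := key j i hij.symm (by rwa [M.symmetric j i])
    rwa [listTake_alternatingWord j i _ _ (by omega), if_neg he] at h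

/-- If `i` and `j` are right descents of the product of `ω`, then that product is represented by
words of the length of `ω` ending in alternating words in `i` and `j` of every length up to
`M i j`. -/
theorem exists_append_alternatingWord {ω : List B} {i j : B} (hij : i ≠ j)
    (hi : cs.IsRightDescent (cs.wordProd ω) i) (hj : cs.IsRightDescent (cs.wordProd ω) j)
    {k : ℕ} (hk : M i j = 0 ∨ k ≤ M i j) :
    ∃ γ : List B, γ.length + k = ω.length ∧
      cs.wordProd (γ ++ alternatingWord i j k) = cs.wordProd ω := by
  induction k generalizing i j with
  | zero => exact ⟨ω, by simp, by simp [alternatingWord]⟩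
  | succ k ih =>
    obtain ⟨γ, hγ, hprod⟩ := ih hij.symm hj hi (by rw [M.symmetric j i]; omega)
    rw [← hprod] at hj
    obtain ⟨p, hp, hpe⟩ := cs.exists_wordProd_mul_simple_eq_eraseIdx hj
    by_cases hpγ : p < γ.length
    · refine ⟨γ.eraseIdx p, by rw [List.length_eraseIdx_of_lt hpγ]; omega, ?_⟩
      rw [List.eraseIdx_append_of_lt_length hpγ] at hpe
      rw [alternatingWord_succ, wordProd_append, wordProd_concat, ← mul_assoc, ← wordProd_append,
        ← hpe, simple_mul_simple_cancel_right, hprod]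
    · exfalso
      rw [List.eraseIdx_append_of_length_le (not_lt.mp hpγ), wordProd_append, wordProd_append,
        mul_assoc, mul_right_inj, ← wordProd_concat, ← alternatingWord_succ] at hpe
      have hlen := (cs.isReduced_alternatingWord hij hk).eq
      have hle := cs.length_wordProd_le ((alternatingWord j i k).eraseIdx (p - γ.length))
      simp only [List.length_append, length_alternatingWord] at hp
      rw [List.length_eraseIdx_of_lt (by rw [length_alternatingWord]; omega), ← hpe, hlen,
        length_alternatingWord, length_alternatingWord] at hle
      omega

theorem IsReduced.of_wordProd_eq {cs : CoxeterSystem M W} {ω τ : List B} (hω : cs.IsReduced ω)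
    (h : cs.wordProd τ = cs.wordProd ω) (hlen : τ.length = ω.length) : cs.IsReduced τ := by
  rw [IsReduced, h, hω.eq, hlen]

/-- If the entries of `M'` are at least those of `M`, then a word that is reduced for both systems
has the same product in the group of `M` as any other reduced word with the same product in the
group of `M'`. -/
theorem wordProd_eq_of_le {W' : Type*} [Group W'] {M' : CoxeterMatrix B}
    (cs' : CoxeterSystem M' W')
    (hle : ∀ s t : B, M' s t = 0 ∨ (M s t ≠ 0 ∧ M s t ≤ M' s t)) {ω τ : List B}
    (hω : cs.IsReduced ω) (hω' : cs'.IsReduced ω) (hτ' : cs'.IsReduced τ)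
    (h : cs'.wordProd ω = cs'.wordProd τ) : cs.wordProd ω = cs.wordProd τ := by
  induction hn : ω.length generalizing ω τ with
  | zero =>
    have hlen : τ.length = ω.length := by rw [← hτ'.eq, ← h, hω'.eq]
    rw [List.length_eq_zero_iff.mp hn, List.length_eq_zero_iff.mp (hlen.trans hn)]
  | succ n ih =>
    have same_last {α β : List B} {i : B} (hα : cs.IsReduced (α.concat i))
        (hα' : cs'.IsReduced (α.concat i)) (hβ' : cs'.IsReduced (β.concat i))
        (hαβ : cs'.wordProd (α.concat i) = cs'.wordProd (β.concat i))
        (hlen : (α.concat i).length = n + 1) :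
        cs.wordProd (α.concat i) = cs.wordProd (β.concat i) := by
      rw [wordProd_concat, wordProd_concat, mul_left_inj] at hαβ ⊢
      have e (l : List B) : (l.concat i).take l.length = l := by simp
      refine ih ?_ ?_ ?_ hαβ (by simpa using hlen)
      · simpa only [e] using hα.take α.length
      · simpa only [e] using hα'.take α.length
      · simpa only [e] using hβ'.take β.length
    have hlen : τ.length = ω.length := by rw [← hτ'.eq, ← h, hω'.eq]
    obtain rfl | ⟨α, i, rfl⟩ := ω.eq_nil_or_concat
    · simp at hn
    obtain rfl | ⟨β, j, rfl⟩ := τ.eq_nil_or_concat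
    · simp at hlen
    rcases eq_or_ne i j with rfl | hij
    · exact same_last hω hω' hτ' h hn
    have descent {α : List B} {i : B} (hα : cs'.IsReduced (α.concat i)) :
        cs'.IsRightDescent (cs'.wordProd (α.concat i)) i := by
      rw [IsRightDescent, hα.eq, wordProd_concat, simple_mul_simple_cancel_right,
        List.length_concat]
      exact Nat.lt_succ_of_le (cs'.length_wordProd_le α)
    have hi := descent hω'
    have hj := descent hτ'
    rw [← h] at hj
    have hM0 : M' i j ≠ 0 := by
      intro h0
      obtain ⟨γ, hγ, -⟩ := cs'.exists_append_alternatingWord hij hi hj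
        (k := (α.concat i).length + 1) (.inl h0)
      omega
    obtain ⟨hM, hMM⟩ := (hle i j).resolve_left hM0
    obtain ⟨γ, hγ, hprod⟩ := cs'.exists_append_alternatingWord hij.symm hj hi
      (.inr (le_refl (M' j i)))
    have hbraid : cs'.wordProd (γ ++ alternatingWord i j (M' i j)) =
        cs'.wordProd (α.concat i) := by
      rw [← hprod, wordProd_append, wordProd_append]
      exact congrArg _ (cs'.wordProd_braidWord_eq i j)
    rw [M'.symmetric j i] at hγ hprod
    have hlast (i' j' : B) : γ ++ alternatingWord i' j' (M' i j) =
        (γ ++ alternatingWord j' i' (M' i j - 1)).concat j' := by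
      obtain ⟨m, hm⟩ := Nat.exists_eq_succ_of_ne_zero hM0
      rw [hm, Nat.succ_eq_add_one, Nat.add_sub_cancel, alternatingWord_succ]
      simp
    have hlen' (i' j' : B) :
        (γ ++ alternatingWord i' j' (M' i j)).length = (α.concat i).length := by
      rw [List.length_append, length_alternatingWord, hγ]
    have hred' := hω'.of_wordProd_eq hprod (hlen' j i)
    have h₁ : cs.wordProd (α.concat i) = cs.wordProd (γ ++ alternatingWord j i (M' i j)) := by
      rw [hlast] at hprod hred' ⊢
      exact same_last hω hω' hred' hprod.symm hn
    have hred := hω.of_wordProd_eq h₁.symm (hlen' j i)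
    have hMeq : M' i j = M i j := by
      refine le_antisymm (not_lt.mp fun hlt ↦ ?_) hMM
      refine cs.not_isReduced_alternatingWord j i (by rwa [M.symmetric j i])
        (by rwa [M.symmetric j i]) ?_ (m := M' i j)
      simpa using hred.drop γ.length
    have h₂ : cs.wordProd (γ ++ alternatingWord j i (M' i j)) =
        cs.wordProd (γ ++ alternatingWord i j (M' i j)) := by
      rw [hMeq, wordProd_append, wordProd_append]
      have hb := cs.wordProd_braidWord_eq j i
      rw [braidWord, braidWord, M.symmetric j i] at hb
      rw [hb]
    have hred₂ := hω.of_wordProd_eq (h₁.trans h₂).symm (hlen' i j)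
    have hred₂' := hω'.of_wordProd_eq hbraid (hlen' i j)
    rw [h₁, h₂]
    rw [← hlen' i j, hlast] at hn
    rw [h, hlast] at hbraid
    rw [hlast] at hred₂ hred₂' ⊢
    exact same_last hred₂ hred₂' hτ' hbraid hn

end CoxeterSystem

/-- Let `W` and `W'` be Coxeter groups on the same generator set `B`, where the
Coxeter matrix `M'` of `W'` is obtained from that of `W` by increasing some
entries (an entry `0` stands for `∞`, which is larger than every natural
number).  Then every word that is a reduced expression in `W` is also a
reduced expression in `W'`. -/
theorem isReduced_of_increase_labels {B : Type*} {W W' : Type*} [Group W] [Group W']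
    {M M' : CoxeterMatrix B} (cs : CoxeterSystem M W) (cs' : CoxeterSystem M' W')
    (hle : ∀ s t : B, M' s t = 0 ∨ (M s t ≠ 0 ∧ M s t ≤ M' s t))
    (ω : List B) (hω : cs.IsReduced ω) : cs'.IsReduced ω := by
  induction ω using List.reverseRecOn with
  | nil => simp [CoxeterSystem.IsReduced]
  | append_singleton ω i ih =>
    have hω₀ : cs.IsReduced ω := by simpa using hω.take ω.length
    have hω₀' := ih hω₀
    rw [← List.concat_eq_append] at hω ⊢
    rw [CoxeterSystem.IsReduced, CoxeterSystem.wordProd_concat, List.length_concat, ← hω₀'.eq,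
      ← CoxeterSystem.not_isRightDescent_iff]
    intro hi
    obtain ⟨k, hk, hprod⟩ := cs'.exists_wordProd_mul_simple_eq_eraseIdx hi
    have hprod' : cs'.wordProd ((ω.eraseIdx k).concat i) = cs'.wordProd ω := by
      rw [CoxeterSystem.wordProd_concat, ← hprod, CoxeterSystem.simple_mul_simple_cancel_right]
    have hlen : (ω.eraseIdx k).length + 1 = ω.length := by
      rw [List.length_eraseIdx_of_lt hk]
      omega
    have h := cs.wordProd_eq_of_le cs' hle hω₀ hω₀'
      (hω₀'.of_wordProd_eq hprod' (by rw [List.length_concat, hlen])) hprod'.symm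
    have hle' := cs.length_wordProd_le (ω.eraseIdx k)
    have hlt := hω.eq
    rw [CoxeterSystem.wordProd_concat, h, CoxeterSystem.wordProd_concat,
      CoxeterSystem.simple_mul_simple_cancel_right, List.length_concat] at hlt
    omega
end

section
/- Let (W,S) be a Coxeter system and suppose u, w ∈ W satisfy: (i) ℓ(u) ≤ ℓ(w); (ii) u ≰_R w in the right weak order; (iv) ℓ(wu) = ℓ(w) + ℓ(u) and every reduced expression for wu is a concatenation of a reduced expression for w and one for u; (v) ℓ(w²) = 2ℓ(w) and every reduced expression for w² is a concatenation of two reduced expressions for w; and (iii) reduced expressions for w use at least 3 distinct generators. Then the set {wᵏu : k ∈ ℕ} is an infinite antichain in the right weak order on W. -/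
/-- The right weak order on a Coxeter group: `v ≤_R w` iff `ℓ(v) + ℓ(v⁻¹w) = ℓ(w)`. -/
def weakLE {B : Type*} {W : Type*} [Group W] {M : CoxeterMatrix B}
    (cs : CoxeterSystem M W) (v w : W) : Prop :=
  cs.length v + cs.length (v⁻¹ * w) = cs.length w

/-- `ω` is a reduced expression for `x`. -/
def IsReducedExprOf {B : Type*} {W : Type*} [Group W] {M : CoxeterMatrix B}
    (cs : CoxeterSystem M W) (ω : List B) (x : W) : Prop :=
  cs.IsReduced ω ∧ cs.wordProd ω = x

namespace CoxeterSystem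

variable {B : Type*} {W : Type*} [Group W] {M : CoxeterMatrix B} (cs : CoxeterSystem M W)

section Exchange

open scoped Classical in
/-- The action of a generator on pairs consisting of a group element and a sign: conjugate the
element, and change the sign exactly at the generator itself. -/
noncomputable def signedConj (i : B) : Function.End (W × ZMod 2) :=
  fun x => (cs.simple i * x.1 * cs.simple i, x.2 + if x.1 = cs.simple i then 1 else 0)

open scoped Classical in
theorem signedConj_mul_pow_apply (i j : B) (n : ℕ) (x : W × ZMod 2) :
    ((cs.signedConj i * cs.signedConj j) ^ n) x =
      ((cs.simple i * cs.simple j) ^ n * x.1 * ((cs.simple i * cs.simple j) ^ n)⁻¹,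
        x.2 + ∑ k ∈ Finset.range (2 * n),
          if x.1 = (cs.simple j * cs.simple i) ^ k * cs.simple j then 1 else 0) := by
  induction n with
  | zero => simp; rfl
  | succ n ih =>
    have hinv : ((cs.simple i * cs.simple j) ^ n)⁻¹ = (cs.simple j * cs.simple i) ^ n := by
      rw [← inv_pow]; simp
    have hsc : (cs.simple j * cs.simple i) ^ n * cs.simple j =
        cs.simple j * (cs.simple i * cs.simple j) ^ n := by
      rw [← mul_pow_mul]
    have h1 : ((cs.simple i * cs.simple j) ^ n * x.1 * ((cs.simple i * cs.simple j) ^ n)⁻¹ =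
        cs.simple j) ↔ x.1 = (cs.simple j * cs.simple i) ^ (2 * n) * cs.simple j := by
      rw [mul_inv_eq_iff_eq_mul, ← eq_inv_mul_iff_mul_eq, hinv, two_mul, pow_add, mul_assoc, hsc]
    have h2 : (cs.simple j * ((cs.simple i * cs.simple j) ^ n * x.1 *
        ((cs.simple i * cs.simple j) ^ n)⁻¹) * cs.simple j = cs.simple i) ↔
        x.1 = (cs.simple j * cs.simple i) ^ (2 * n + 1) * cs.simple j := by
      have e : (cs.simple j * cs.simple i) ^ (2 * n + 1) * cs.simple j =
          (cs.simple j * cs.simple i) ^ n * (cs.simple j * cs.simple i * cs.simple j) *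
            (cs.simple i * cs.simple j) ^ n := by
        rw [show 2 * n + 1 = n + 1 + n by ring, pow_add, mul_assoc, hsc, pow_succ]
        simp only [mul_assoc]
      rw [e, ← hinv]
      constructor
      · intro h
        have hx : ∀ g : W, x.1 = g⁻¹ *
            (cs.simple j * (cs.simple j * (g * x.1 * g⁻¹) * cs.simple j) * cs.simple j) * g := by
          intro g; simp [mul_assoc]
        have hx := hx ((cs.simple i * cs.simple j) ^ n)
        rwa [h] at hx
      · intro h
        rw [h]
        simp [mul_assoc]
    rw [pow_succ']
    change cs.signedConj i (cs.signedConj j (((cs.signedConj i * cs.signedConj j) ^ n) x)) = _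
    rw [ih]
    simp only [signedConj]
    refine Prod.ext ?_ ?_
    · simp [pow_succ', mul_assoc]
    · simp only [h1, h2]
      rw [show 2 * (n + 1) = 2 * n + 1 + 1 by ring, Finset.sum_range_succ, Finset.sum_range_succ]
      ring

theorem isLiftable_signedConj : M.IsLiftable cs.signedConj := by
  classical
  intro i j
  funext x
  rw [signedConj_mul_pow_apply]
  refine Prod.ext (by simp; rfl) ?_
  rw [two_mul, Finset.sum_range_add]
  simp only [pow_add, cs.simple_mul_simple_pow', one_mul]
  change x.2 + _ = x.2
  rw [CharTwo.add_self_eq_zero, add_zero]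

open scoped Classical in
theorem lift_signedConj_wordProd (ω : List B) (x : W × ZMod 2) :
    cs.lift ⟨cs.signedConj, cs.isLiftable_signedConj⟩ (cs.wordProd ω) x =
      (cs.wordProd ω * x.1 * (cs.wordProd ω)⁻¹,
        x.2 + ((cs.rightInvSeq ω).count x.1 : ZMod 2)) := by
  induction ω with
  | nil => simp; rfl
  | cons i ω ih =>
    rw [wordProd_cons, map_mul, lift_apply_simple]
    change cs.signedConj i (cs.lift ⟨cs.signedConj, cs.isLiftable_signedConj⟩ (cs.wordProd ω) x) = _
    rw [ih]
    refine Prod.ext ?_ ?_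
    · simp [signedConj, mul_assoc]
    · have h : (cs.wordProd ω * x.1 * (cs.wordProd ω)⁻¹ = cs.simple i) ↔
          (cs.wordProd ω)⁻¹ * cs.simple i * cs.wordProd ω = x.1 := by
        rw [mul_inv_eq_iff_eq_mul, ← eq_inv_mul_iff_mul_eq, ← mul_assoc, eq_comm]
      simp only [signedConj, rightInvSeq, List.count_cons, h, beq_iff_eq]
      push_cast
      ring

/-- The parity of the multiplicity of an element in the right inversion sequence of a word depends
only on the product of the word. -/
theorem count_rightInvSeq_congr [DecidableEq W] {ω ω' : List B}
    (h : cs.wordProd ω = cs.wordProd ω') (t : W) :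
    ((cs.rightInvSeq ω).count t : ZMod 2) = (cs.rightInvSeq ω').count t := by
  have h1 := cs.lift_signedConj_wordProd ω (t, 0)
  rw [h, cs.lift_signedConj_wordProd ω' (t, 0)] at h1
  have h2 := congrArg Prod.snd h1
  simp only [zero_add] at h2
  convert h2.symm

theorem mem_rightInvSeq_of_isRightDescent {ω : List B} {i : B}
    (h : cs.IsRightDescent (cs.wordProd ω) i) : cs.simple i ∈ cs.rightInvSeq ω := by
  classical
  obtain ⟨a, ha, hae⟩ := cs.exists_isReduced (cs.wordProd ω * cs.simple i)
  have hprod : cs.wordProd ω = cs.wordProd (a.concat i) := by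
    rw [wordProd_concat, ← hae]; simp
  have hred : cs.IsReduced (a.concat i) := by
    have := cs.isRightDescent_iff.1 h
    rw [IsReduced, ← hprod, ← this, hae, ha.eq]
    simp
  have hmem : cs.simple i ∈ cs.rightInvSeq (a.concat i) := by
    rw [rightInvSeq_concat]; simp
  have h1 := List.count_eq_one_of_mem hred.nodup_rightInvSeq hmem
  have h2 := cs.count_rightInvSeq_congr hprod (cs.simple i)
  rw [h1] at h2
  by_contra hn
  rw [List.count_eq_zero_of_not_mem hn] at h2
  simp at h2

/-- The exchange property. -/
theorem exists_exchange {ω : List B} {i : B} (h : cs.IsLeftDescent (cs.wordProd ω) i) :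
    ∃ a k b, ω = a ++ k :: b ∧ cs.simple i * cs.wordProd ω = cs.wordProd (a ++ b) := by
  have h' : cs.IsRightDescent (cs.wordProd ω.reverse) i := by
    rw [wordProd_reverse]; exact cs.isRightDescent_inv_iff.2 h
  obtain ⟨n, hn, hne⟩ := List.mem_iff_getElem.1 (cs.mem_rightInvSeq_of_isRightDescent h')
  have he := cs.wordProd_mul_getD_rightInvSeq ω.reverse n
  rw [List.getD_eq_getElem _ _ hn, hne, List.eraseIdx_eq_take_drop_succ] at he
  rw [length_rightInvSeq] at hn
  refine ⟨(ω.reverse.drop (n + 1)).reverse, ω.reverse[n], (ω.reverse.take n).reverse, ?_, ?_⟩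
  · have hsplit := List.take_append_drop n ω.reverse
    rw [List.drop_eq_getElem_cons hn] at hsplit
    have hsplit := congrArg List.reverse hsplit
    rw [List.reverse_append, List.reverse_cons, List.reverse_reverse, List.append_assoc] at hsplit
    exact hsplit.symm
  · rw [← List.reverse_append, wordProd_reverse, ← he]
    simp

end Exchange

section RankTwoMoves

variable {cs}

theorem IsReduced.of_append_left {a b : List B} (h : cs.IsReduced (a ++ b)) : cs.IsReduced a := by
  simpa using h.take a.length

theorem IsReduced.of_append_right {a b : List B} (h : cs.IsReduced (a ++ b)) :
    cs.IsReduced b := by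
  simpa using h.drop a.length

theorem isReduced_cons_of_not_isLeftDescent {i : B} {ω : List B} (hω : cs.IsReduced ω)
    (h : ¬ cs.IsLeftDescent (cs.wordProd ω) i) : cs.IsReduced (i :: ω) := by
  rw [not_isLeftDescent_iff] at h
  rw [IsReduced, wordProd_cons, h, hω.eq, List.length_cons]

variable (cs)

theorem exists_shortest_word (S : Set B) (h : List B) (hS : ∀ k ∈ h, k ∈ S) :
    ∃ h', (∀ k ∈ h', k ∈ S) ∧ cs.wordProd h' = cs.wordProd h ∧
      ∀ g, (∀ k ∈ g, k ∈ S) → cs.wordProd g = cs.wordProd h' → h'.length ≤ g.length := by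
  obtain ⟨h', ⟨h1, h2⟩, hmin⟩ := exists_minimalFor_of_wellFoundedLT
    (fun g : List B => (∀ k ∈ g, k ∈ S) ∧ cs.wordProd g = cs.wordProd h) List.length ⟨h, hS, rfl⟩
  refine ⟨h', h1, h2, fun g hg hge => ?_⟩
  rcases le_total h'.length g.length with hl | hl
  · exact hl
  · exact hmin ⟨hg, hge.trans h2⟩ hl

/-- A shortest representative `c` of a left-parabolic coset may be prefixed by any shortest word of
the parabolic subgroup. -/
theorem isReduced_append_of_shortest (S : Set B) {c : List B}
    (hc : ∀ h d, (∀ k ∈ h, k ∈ S) → cs.wordProd c = cs.wordProd h * cs.wordProd d →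
      c.length ≤ d.length) (h : List B) (hS : ∀ k ∈ h, k ∈ S)
    (hmin : ∀ g, (∀ k ∈ g, k ∈ S) → cs.wordProd g = cs.wordProd h → h.length ≤ g.length) :
    cs.IsReduced (h ++ c) := by
  induction h with
  | nil =>
    obtain ⟨d, hd, hde⟩ := cs.exists_isReduced (cs.wordProd c)
    have := hc [] d (by simp) (by simpa using hde)
    have h2 := cs.length_wordProd_le c
    rw [List.nil_append, IsReduced]
    rw [hde, hd.eq] at h2 ⊢
    omega
  | cons k h ih =>
    have hSh : ∀ l ∈ h, l ∈ S := fun l hl => hS l (List.mem_cons_of_mem _ hl)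
    have hk : k ∈ S := hS k List.mem_cons_self
    have hr : cs.IsReduced (h ++ c) := by
      refine ih hSh fun g hg hge => ?_
      have := hmin (k :: g) (by simpa [hk] using hg) (by rw [wordProd_cons, hge, wordProd_cons])
      simpa using this
    have hcoset : ∀ d, cs.simple k * (cs.wordProd h * cs.wordProd c) =
        cs.wordProd h * cs.wordProd d → c.length ≤ d.length := by
      intro d hd
      refine hc (h.reverse ++ k :: h) d ?_ ?_
      · intro m hm
        simp only [List.mem_append, List.mem_reverse, List.mem_cons] at hm
        rcases hm with hm | rfl | hm
        exacts [hSh m hm, hk, hSh m hm]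
      · rw [wordProd_append, wordProd_reverse, wordProd_cons, mul_assoc, mul_assoc, ← hd]
        simp
    rw [List.cons_append]
    refine isReduced_cons_of_not_isLeftDescent hr fun hdes => ?_
    obtain ⟨a, l, b, hab, hprod⟩ := cs.exists_exchange hdes
    rcases List.append_eq_append_iff.1 hab with ⟨e, rfl, rfl⟩ | ⟨e, rfl, he⟩
    · rw [List.append_assoc, wordProd_append _ h, wordProd_append _ h] at hprod
      simpa using hcoset _ hprod
    · rcases e with _ | ⟨m, e⟩
      · simp only [List.nil_append] at he
        subst he
        simp only [List.append_nil] at *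
        rw [wordProd_append _ a, wordProd_append _ a] at hprod
        simpa using hcoset _ hprod
      · simp only [List.cons_append, List.cons.injEq] at he
        obtain ⟨rfl, rfl⟩ := he
        have := hmin (a ++ e) (by
          intro m hm
          refine hSh m ?_
          simp only [List.mem_append, List.mem_cons] at hm ⊢
          tauto) (by
            rw [← List.append_assoc, wordProd_append _ _ c, wordProd_append _ _ c, ← mul_assoc,
              mul_left_inj] at hprod
            rw [wordProd_cons, hprod])
        simp at this

/-- If `i` and `j` are left descents of `x`, then `x` has reduced expressions starting with `i` and
with `j` that differ only in a prefix in the letters `i` and `j`. -/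
theorem exists_common_suffix {x : W} {i j : B} (hi : cs.IsLeftDescent x i)
    (hj : cs.IsLeftDescent x j) :
    ∃ p q c : List B, (∀ k ∈ p, k ∈ ({i, j} : Set B)) ∧ (∀ k ∈ q, k ∈ ({i, j} : Set B)) ∧
      p.length = q.length ∧ cs.wordProd (i :: p) = cs.wordProd (j :: q) ∧
      cs.IsReduced (i :: (p ++ c)) ∧ cs.wordProd (i :: (p ++ c)) = x := by
  set S : Set B := {i, j}
  have hiS : i ∈ S := by simp [S]
  have hjS : j ∈ S := by simp [S]
  obtain ⟨ω, hω⟩ := cs.wordProd_surjective x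
  obtain ⟨c, ⟨h, hhS, hx⟩, hmin⟩ := exists_minimalFor_of_wellFoundedLT
    (fun c : List B => ∃ h : List B, (∀ k ∈ h, k ∈ S) ∧ x = cs.wordProd h * cs.wordProd c)
    List.length ⟨ω, [], by simp, by simp [hω]⟩
  have hc : ∀ g d, (∀ k ∈ g, k ∈ S) → cs.wordProd c = cs.wordProd g * cs.wordProd d →
      c.length ≤ d.length := by
    intro g d hg hcd
    rcases le_total c.length d.length with hl | hl
    · exact hl
    · refine hmin ⟨h ++ g, ?_, ?_⟩ hl
      · intro k hk
        rcases List.mem_append.1 hk with hk | hk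
        exacts [hhS k hk, hg k hk]
      · rw [hx, hcd, wordProd_append, mul_assoc]
  have key : ∀ k ∈ S, cs.IsLeftDescent x k → ∃ p : List B, (∀ l ∈ p, l ∈ S) ∧
      cs.wordProd (k :: p) = cs.wordProd h ∧ p.length + c.length + 1 = cs.length x := by
    intro k hk hdes
    obtain ⟨p, hpS, hp, hpmin⟩ := cs.exists_shortest_word S (k :: h) (by simpa [hk] using hhS)
    have hred := cs.isReduced_append_of_shortest S hc p hpS hpmin
    refine ⟨p, hpS, by rw [wordProd_cons, hp, wordProd_cons]; simp, ?_⟩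
    rw [← cs.isLeftDescent_iff.1 hdes, hx, ← List.length_append, ← hred.eq, wordProd_append, hp,
      wordProd_cons, mul_assoc]
  obtain ⟨p, hpS, hp, hpl⟩ := key i hiS hi
  obtain ⟨q, hqS, hq, hql⟩ := key j hjS hj
  have hpx : cs.wordProd (i :: (p ++ c)) = x := by
    rw [← List.cons_append, wordProd_append, hp, hx]
  refine ⟨p, q, c, hpS, hqS, by omega, hp.trans hq.symm, ?_, hpx⟩
  rw [IsReduced, hpx, ← hpl]
  simp

/-- Replacement of a factor in at most two letters by a word in these letters with the same length
and the same product. -/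
def RankTwoMove (ω ω' : List B) : Prop :=
  ∃ (i j : B) (a p q b : List B), ω = a ++ p ++ b ∧ ω' = a ++ q ++ b ∧
    (∀ k ∈ p, k ∈ ({i, j} : Set B)) ∧ p.length = q.length ∧ cs.wordProd p = cs.wordProd q

variable {cs} in
theorem RankTwoMove.append_left {ω ω' : List B} (h : cs.RankTwoMove ω ω') (c : List B) :
    cs.RankTwoMove (c ++ ω) (c ++ ω') := by
  obtain ⟨i, j, a, p, q, b, rfl, rfl, h⟩ := h
  exact ⟨i, j, c ++ a, p, q, b, by simp, by simp, h⟩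

variable {cs} in
theorem reflTransGen_rankTwoMove_append_left {ω ω' : List B}
    (h : Relation.ReflTransGen cs.RankTwoMove ω ω') (c : List B) :
    Relation.ReflTransGen cs.RankTwoMove (c ++ ω) (c ++ ω') :=
  h.lift (c ++ ·) fun _ _ h => h.append_left c

/-- Any two reduced expressions of an element are connected by rank two moves. -/
theorem reflTransGen_rankTwoMove {ω ω' : List B} (hω : cs.IsReduced ω) (hω' : cs.IsReduced ω')
    (h : cs.wordProd ω = cs.wordProd ω') : Relation.ReflTransGen cs.RankTwoMove ω ω' := by
  induction hn : ω.length generalizing ω ω' with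
  | zero =>
    have hl : ω'.length = 0 := by rw [← hω'.eq, ← h, hω.eq, hn]
    rw [List.length_eq_zero_iff.1 hn, List.length_eq_zero_iff.1 hl]
  | succ n ih =>
    have hl : ω'.length = n + 1 := by rw [← hω'.eq, ← h, hω.eq, hn]
    obtain ⟨i, a, rfl⟩ := List.exists_cons_of_length_eq_add_one hn
    obtain ⟨j, b, rfl⟩ := List.exists_cons_of_length_eq_add_one hl
    have ha : cs.IsReduced a := hω.of_append_right (a := [i])
    have hb : cs.IsReduced b := hω'.of_append_right (a := [j])
    have hi : cs.IsLeftDescent (cs.wordProd (i :: a)) i := by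
      rw [IsLeftDescent, hω.eq, wordProd_cons]
      simp [ha.eq]
    have hj : cs.IsLeftDescent (cs.wordProd (i :: a)) j := by
      rw [IsLeftDescent, h, hω'.eq, wordProd_cons]
      simp [hb.eq]
    obtain ⟨p, q, c, hp, hq, hpq, hprod, hred, hx⟩ := cs.exists_common_suffix hi hj
    have hx' : cs.wordProd (j :: (q ++ c)) = cs.wordProd (i :: a) := by
      rw [← List.cons_append, wordProd_append, ← hprod, ← wordProd_append, List.cons_append, hx]
    have hred' : cs.IsReduced (j :: (q ++ c)) := by
      rw [IsReduced, hx', ← hx, hred.eq]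
      simp [hpq]
    have s1 : Relation.ReflTransGen cs.RankTwoMove (i :: a) (i :: (p ++ c)) := by
      refine reflTransGen_rankTwoMove_append_left
        (ih ha (hred.of_append_right (a := [i])) ?_ (by simpa using hn)) [i]
      rw [wordProd_cons, wordProd_cons, mul_right_inj] at hx
      exact hx.symm
    have s3 : Relation.ReflTransGen cs.RankTwoMove (j :: (q ++ c)) (j :: b) := by
      refine reflTransGen_rankTwoMove_append_left
        (ih (hred'.of_append_right (a := [j])) hb ?_ ?_) [j]
      · rw [h, wordProd_cons, wordProd_cons, mul_right_inj] at hx'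
        exact hx'
      · have h1 := hred'.eq
        rw [hx', hω.eq, hn] at h1
        simpa using h1.symm
    have s2 : cs.RankTwoMove (i :: (p ++ c)) (j :: (q ++ c)) := by
      refine ⟨i, j, [], i :: p, j :: q, c, by simp, by simp, ?_, by simpa using hpq, hprod⟩
      simpa using hp
    exact s1.trans (s3.head s2)

end RankTwoMoves

section BlockWords

variable (u w : W)

/-- Concatenations of `k` reduced expressions for `w` and a reduced expression for `u`. -/
def IsBlockWord : ℕ → List B → Prop
  | 0, ω => IsReducedExprOf cs ω u
  | k + 1, ω => ∃ a b, ω = a ++ b ∧ IsReducedExprOf cs a w ∧ IsBlockWord k b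

variable {cs} in
theorem _root_.IsReducedExprOf.length_eq {ω : List B} {x : W} (h : IsReducedExprOf cs ω x) :
    ω.length = cs.length x := by
  rw [← h.2, h.1.eq]

variable {cs} in
theorem _root_.IsReducedExprOf.append {a b : List B} {x y : W} (ha : IsReducedExprOf cs a x)
    (hb : IsReducedExprOf cs b y) (h : cs.length (x * y) = cs.length x + cs.length y) :
    IsReducedExprOf cs (a ++ b) (x * y) := by
  have hp : cs.wordProd (a ++ b) = x * y := by rw [wordProd_append, ha.2, hb.2]
  refine ⟨?_, hp⟩
  rw [IsReduced, hp, h, List.length_append, ha.length_eq, hb.length_eq]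

variable {cs} in
/-- A factor of a reduced expression may be replaced by a word of the same length and product. -/
theorem _root_.IsReducedExprOf.replace {a p q b : List B} {x : W}
    (h : IsReducedExprOf cs (a ++ p ++ b) x) (hl : p.length = q.length)
    (hp : cs.wordProd p = cs.wordProd q) :
    cs.IsReduced p ∧ IsReducedExprOf cs (a ++ q ++ b) x := by
  have hx : cs.wordProd (a ++ q ++ b) = x := by
    rw [← h.2]; simp only [wordProd_append, hp]
  refine ⟨h.1.of_append_left.of_append_right, ?_, hx⟩
  rw [IsReduced, hx, ← h.length_eq]
  simp [hl]

theorem exists_isReducedExprOf (x : W) : ∃ ω, IsReducedExprOf cs ω x := by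
  obtain ⟨ω, h, h'⟩ := cs.exists_isReduced x
  exact ⟨ω, h, h'.symm⟩

theorem exists_isBlockWord (k : ℕ) : ∃ ω, cs.IsBlockWord u w k ω := by
  induction k with
  | zero => exact cs.exists_isReducedExprOf u
  | succ k ih =>
    obtain ⟨b, hb⟩ := ih
    obtain ⟨a, ha⟩ := cs.exists_isReducedExprOf w
    exact ⟨a ++ b, a, b, rfl, ha, hb⟩

variable {cs u w}

theorem IsBlockWord.wordProd_eq {k : ℕ} {ω : List B} (h : cs.IsBlockWord u w k ω) :
    cs.wordProd ω = w ^ k * u := by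
  induction k generalizing ω with
  | zero => simpa using h.2
  | succ k ih =>
    obtain ⟨a, b, rfl, ha, hb⟩ := h
    rw [wordProd_append, ha.2, ih hb, pow_succ', mul_assoc]

theorem IsBlockWord.length_eq {k : ℕ} {ω : List B} (h : cs.IsBlockWord u w k ω) :
    ω.length = k * cs.length w + cs.length u := by
  induction k generalizing ω with
  | zero => simpa using IsReducedExprOf.length_eq h
  | succ k ih =>
    obtain ⟨a, b, rfl, ha, hb⟩ := h
    rw [List.length_append, ha.length_eq, ih hb]
    ring

/-- A block word having a block word with fewer blocks as a prefix forces `u ≤ w`. -/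
theorem IsBlockWord.weakLE_of_prefix (h1 : cs.length u ≤ cs.length w) {j k : ℕ} (hjk : j < k)
    {a c : List B} (ha : cs.IsBlockWord u w j a) (hac : cs.IsBlockWord u w k (a ++ c)) :
    weakLE cs u w := by
  induction j generalizing k a with
  | zero =>
    obtain ⟨k, rfl⟩ := Nat.exists_eq_succ_of_ne_zero hjk.ne'
    obtain ⟨d, e, hde, hd, -⟩ := hac
    have ha' : IsReducedExprOf cs a u := ha
    have hpre : a <+: d := List.prefix_of_prefix_length_le ⟨c, hde⟩ ⟨e, rfl⟩
      (by rw [ha'.length_eq, hd.length_eq]; exact h1)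
    obtain ⟨f, rfl⟩ := hpre
    have hf : u⁻¹ * w = cs.wordProd f := by
      rw [← hd.2, ← ha'.2, wordProd_append]; simp
    rw [weakLE, hf, hd.1.of_append_right.eq, ← ha'.length_eq, ← hd.length_eq, List.length_append]
  | succ j ih =>
    obtain ⟨k, rfl⟩ := Nat.exists_eq_succ_of_ne_zero (Nat.ne_zero_of_lt hjk)
    obtain ⟨d, e, hde, hd, he⟩ := hac
    obtain ⟨a₁, a₂, rfl, ha₁, ha₂⟩ := ha
    rw [List.append_assoc] at hde
    obtain ⟨-, rfl⟩ := List.append_inj hde (by rw [ha₁.length_eq, hd.length_eq])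
    exact ih (Nat.lt_of_succ_lt_succ hjk) ha₂ he

theorem not_subset_pair_of_three_le_card [DecidableEq B] {ω : List B}
    (h : 3 ≤ ω.toFinset.card) (i j : B) : ¬ ∀ k ∈ ω, k ∈ ({i, j} : Set B) := by
  intro hk
  have : ω.toFinset ⊆ {i, j} := by
    intro k hkω
    simpa using hk k (by simpa using hkω)
  have := (Finset.card_le_card this).trans Finset.card_le_two
  omega

variable [DecidableEq B]
  (h3 : ∀ ω : List B, IsReducedExprOf cs ω w → 3 ≤ ω.toFinset.card)
  (h4 : cs.length (w * u) = cs.length w + cs.length u ∧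
    ∀ ω : List B, IsReducedExprOf cs ω (w * u) →
      ∃ ω₁ ω₂ : List B, ω = ω₁ ++ ω₂ ∧
        IsReducedExprOf cs ω₁ w ∧ IsReducedExprOf cs ω₂ u)
  (h5 : cs.length (w * w) = 2 * cs.length w ∧
    ∀ ω : List B, IsReducedExprOf cs ω (w * w) →
      ∃ ω₁ ω₂ : List B, ω = ω₁ ++ ω₂ ∧
        IsReducedExprOf cs ω₁ w ∧ IsReducedExprOf cs ω₂ w)

include h3 h4 h5

theorem IsBlockWord.replace {i j : B} {k : ℕ} {a p q b : List B}
    (h : cs.IsBlockWord u w k (a ++ p ++ b)) (hp : ∀ l ∈ p, l ∈ ({i, j} : Set B))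
    (hl : p.length = q.length) (hprod : cs.wordProd p = cs.wordProd q) :
    cs.IsReduced p ∧ cs.IsBlockWord u w k (a ++ q ++ b) := by
  induction k generalizing a with
  | zero => exact IsReducedExprOf.replace h hl hprod
  | succ k ih =>
    obtain ⟨d, e, hde, hd, he⟩ := h
    rw [List.append_assoc] at hde
    rcases List.append_eq_append_iff.1 hde with ⟨f, rfl, hf⟩ | ⟨f, rfl, rfl⟩
    · rcases List.append_eq_append_iff.1 hf with ⟨g, rfl, rfl⟩ | ⟨g, rfl, rfl⟩
      · rw [← List.append_assoc] at hd
        obtain ⟨h1, h2⟩ := hd.replace hl hprod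
        exact ⟨h1, a ++ q ++ g, e, by simp, h2, he⟩
      · cases k with
        | zero =>
          have hr : IsReducedExprOf cs (a ++ (f ++ g) ++ b) (w * u) := by
            simpa using hd.append he h4.1
          obtain ⟨h1, h2⟩ := hr.replace hl hprod
          obtain ⟨ω₁, ω₂, h, h', h''⟩ := h4.2 _ h2
          exact ⟨h1, ω₁, ω₂, h, h', h''⟩
        | succ k =>
          obtain ⟨d₂, e₂, hde₂, hd₂, he₂⟩ := he
          rcases List.append_eq_append_iff.1 hde₂ with ⟨r, rfl, rfl⟩ | ⟨r, rfl, rfl⟩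
          · have hr : IsReducedExprOf cs (a ++ (f ++ g) ++ r) (w * w) := by
              simpa using hd.append hd₂ (by rw [h5.1, two_mul])
            obtain ⟨h1, h2⟩ := hr.replace hl hprod
            obtain ⟨ω₁, ω₂, h, h', h''⟩ := h5.2 _ h2
            refine ⟨h1, ω₁, ω₂ ++ e₂, ?_, h', ω₂, e₂, rfl, h'', he₂⟩
            rw [← List.append_assoc, ← List.append_assoc, h]
          · refine absurd (fun l hl => hp l ?_) (not_subset_pair_of_three_le_card (h3 _ hd₂) i j)
            simp [hl]
    · rw [← List.append_assoc] at he
      obtain ⟨h1, h2⟩ := ih he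
      exact ⟨h1, d, f ++ q ++ b, by simp, hd, h2⟩

theorem IsBlockWord.of_reflTransGen {k : ℕ} {ω ω' : List B} (h : cs.IsBlockWord u w k ω)
    (hr : Relation.ReflTransGen cs.RankTwoMove ω ω') : cs.IsBlockWord u w k ω' := by
  induction hr with
  | refl => exact h
  | tail _ hm ih =>
    obtain ⟨i, j, a, p, q, b, rfl, rfl, hp, hl, hprod⟩ := hm
    exact (ih.replace h3 h4 h5 hp hl hprod).2

theorem IsBlockWord.isReduced {k : ℕ} {ω : List B} (h : cs.IsBlockWord u w k ω) :
    cs.IsReduced ω := by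
  suffices H : ∀ b a : List B, cs.IsBlockWord u w k (a ++ b) → cs.IsReduced b from H ω [] h
  intro b
  induction b with
  | nil => intro a _; simp [IsReduced]
  | cons i b ih =>
    intro a hab
    have hb : cs.IsReduced b := ih (a ++ [i]) (by simpa using hab)
    refine isReduced_cons_of_not_isLeftDescent hb fun hdes => ?_
    obtain ⟨c, hc, hce⟩ := cs.exists_isReduced (cs.simple i * cs.wordProd b)
    have hprod : cs.wordProd b = cs.wordProd (i :: c) := by
      rw [wordProd_cons, ← hce]; simp
    have hred : cs.IsReduced (i :: c) := by
      rw [IsReduced, ← hprod, ← cs.isLeftDescent_iff.1 hdes, hce, hc.eq, List.length_cons]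
    have hmove := reflTransGen_rankTwoMove_append_left
      (cs.reflTransGen_rankTwoMove hb hred hprod) (a ++ [i])
    have hblock : cs.IsBlockWord u w k (a ++ [i, i] ++ c) := by
      simpa using IsBlockWord.of_reflTransGen h3 h4 h5 (by simpa using hab) hmove
    have := (hblock.replace h3 h4 h5 (i := i) (j := i) (q := [i, i]) (by simp) rfl rfl).1
    simp [IsReduced, wordProd_cons] at this

theorem IsBlockWord.of_isReducedExprOf {k : ℕ} {ω : List B}
    (h : IsReducedExprOf cs ω (w ^ k * u)) : cs.IsBlockWord u w k ω := by
  obtain ⟨ω', hω'⟩ := cs.exists_isBlockWord u w k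
  exact hω'.of_reflTransGen h3 h4 h5 (cs.reflTransGen_rankTwoMove
    (hω'.isReduced h3 h4 h5) h.1 (hω'.wordProd_eq.trans h.2.symm))

theorem length_pow_mul_of_blocks (k : ℕ) :
    cs.length (w ^ k * u) = k * cs.length w + cs.length u := by
  obtain ⟨ω, hω⟩ := cs.exists_isBlockWord u w k
  rw [← hω.length_eq, ← (hω.isReduced h3 h4 h5).eq, hω.wordProd_eq]

end BlockWords

end CoxeterSystem

/-- The antichain lemma: if `u, w` form a *good pair*, i.e.
(i) `ℓ(u) ≤ ℓ(w)`;
(ii) `u ≰_R w`;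
(iii) reduced expressions for `w` use at least `3` distinct generators;
(iv) `ℓ(wu) = ℓ(w) + ℓ(u)` and every reduced expression for `wu` is a
concatenation of a reduced expression for `w` and one for `u`;
(v) `ℓ(w²) = 2ℓ(w)` and every reduced expression for `w²` is a concatenation of
two reduced expressions for `w`;
then `{wᵏu : k ∈ ℕ}` is an infinite antichain in the right weak order. -/
theorem antichain_of_good_pair {B : Type*} [DecidableEq B] {W : Type*} [Group W]
    {M : CoxeterMatrix B} (cs : CoxeterSystem M W) (u w : W)
    (h1 : cs.length u ≤ cs.length w)
    (h2 : ¬ weakLE cs u w)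
    (h3 : ∀ ω : List B, IsReducedExprOf cs ω w → 3 ≤ ω.toFinset.card)
    (h4 : cs.length (w * u) = cs.length w + cs.length u ∧
      ∀ ω : List B, IsReducedExprOf cs ω (w * u) →
        ∃ ω₁ ω₂ : List B, ω = ω₁ ++ ω₂ ∧
          IsReducedExprOf cs ω₁ w ∧ IsReducedExprOf cs ω₂ u)
    (h5 : cs.length (w * w) = 2 * cs.length w ∧
      ∀ ω : List B, IsReducedExprOf cs ω (w * w) →
        ∃ ω₁ ω₂ : List B, ω = ω₁ ++ ω₂ ∧
          IsReducedExprOf cs ω₁ w ∧ IsReducedExprOf cs ω₂ w) :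
    (Set.range fun k : ℕ => w ^ k * u).Infinite ∧
      IsAntichain (weakLE cs) (Set.range fun k : ℕ => w ^ k * u) := by
  have hlen := CoxeterSystem.length_pow_mul_of_blocks h3 h4 h5
  have hw : 0 < cs.length w := by
    obtain ⟨ω, hω⟩ := cs.exists_isReducedExprOf w
    have h := (h3 ω hω).trans (List.toFinset_card_le ω)
    rw [hω.length_eq] at h
    omega
  refine ⟨Set.infinite_range_of_injective fun j k hjk => ?_, ?_⟩
  · have h := congrArg cs.length hjk
    simp only [hlen, Nat.add_right_cancel_iff] at h
    exact Nat.eq_of_mul_eq_mul_right hw h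
  · rintro _ ⟨j, rfl⟩ _ ⟨k, rfl⟩ hne hle
    have hjk : j < k := by
      refine lt_of_le_of_ne ?_ fun h => hne (by rw [h])
      have h : cs.length (w ^ j * u) ≤ cs.length (w ^ k * u) := by
        rw [← (show _ + _ = _ from hle)]; exact Nat.le_add_right _ _
      rw [hlen, hlen] at h
      exact Nat.le_of_mul_le_mul_right (Nat.le_of_add_le_add_right h) hw
    obtain ⟨a, ha⟩ := cs.exists_isReducedExprOf (w ^ j * u)
    obtain ⟨c, hc⟩ := cs.exists_isReducedExprOf ((w ^ j * u)⁻¹ * (w ^ k * u))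
    have hac := ha.append hc (by rw [mul_inv_cancel_left]; exact hle.symm)
    rw [mul_inv_cancel_left] at hac
    exact h2 (CoxeterSystem.IsBlockWord.weakLE_of_prefix h1 hjk
      (CoxeterSystem.IsBlockWord.of_isReducedExprOf h3 h4 h5 ha)
      (CoxeterSystem.IsBlockWord.of_isReducedExprOf h3 h4 h5 hac))
end

section
/- Let (W,S) be a Coxeter system whose diagram is a cycle s₁, s₂, ..., sₙ, s₁ with m(s₁,sₙ) = 4 and all other consecutive labels equal to 3 (non-consecutive generators commute). Then the elements u = sₙ and w = s₂s₃⋯sₙs₁ form a good pair: ℓ(u) ≤ ℓ(w), u ≰_R w, |S(w)| ≥ 3, every reduced expression for wu is a concatenation of reduced expressions for w and u, and every reduced expression for w² is a concatenation of two reduced expressions for w. Consequently {wᵏu : k ∈ ℕ} is an infinite antichain in the right weak order. -/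
namespace CyclePath

/-- The generator attached to the vertex `x` of the path. -/
def label (n x : ℕ) : ZMod n := -1 - x

/-- The neighbour of `x` whose label is one larger. -/
def up (n x : ℕ) : ℕ := if x = 0 then 2 * n - 1 else x - 1

/-- The second neighbour with a smaller label of a vertex labelled `0`; it differs from the first
one, `x + 1`, only at the branching vertex `2 * n - 1`. -/
def branch (n x : ℕ) : ℕ := if x = 2 * n - 1 then 0 else x + 1

/-- The sum of the values of `f` at the neighbours of `x`. -/
def neighborSum (n : ℕ) (f : ℕ → ℤ) (x : ℕ) : ℤ :=
  f (up n x) + f (x + 1) + if label n x = 0 then f (branch n x) else 0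

/-- The operator `b i` such that `1 - b i` is the action of the generator `i`. -/
def root (n : ℕ) (i : ZMod n) : Module.End ℤ (ℕ → ℤ) where
  toFun f x := if label n x = i then 2 * f x - neighborSum n f x else 0
  map_add' f g := by
    ext x
    simp only [neighborSum, Pi.add_apply]
    split_ifs <;> ring
  map_smul' c f := by
    ext x
    simp only [neighborSum, Pi.smul_apply, smul_eq_mul, RingHom.id_apply]
    split_ifs <;> ring

variable {n : ℕ}

theorem label_up (hn : 3 ≤ n) (x : ℕ) : label n (up n x) = label n x + 1 := by
  unfold label up
  split_ifs with h
  · subst h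
    rw [Nat.cast_sub (by omega)]
    simp
  · rw [Nat.cast_sub (by omega)]
    push_cast
    ring

theorem label_succ (x : ℕ) : label n (x + 1) = label n x - 1 := by
  simp only [label]
  push_cast
  ring

theorem label_branch (hn : 3 ≤ n) (x : ℕ) : label n (branch n x) = label n x - 1 := by
  unfold branch
  split_ifs with h
  · subst h
    simp only [label]
    rw [Nat.cast_sub (by omega)]
    simp
  · exact label_succ x

theorem up_succ (x : ℕ) : up n (x + 1) = x := by simp [up]

theorem up_branch (x : ℕ) : up n (branch n x) = x := by
  unfold branch
  split_ifs with h
  · simp [up, h]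
  · exact up_succ x

theorem up_add_one {x : ℕ} (hx : label n x ≠ -1) : up n x + 1 = x := by
  have : x ≠ 0 := by
    rintro rfl
    simp [label] at hx
  simp only [up, this, if_false]
  omega

theorem root_apply (i : ZMod n) (f : ℕ → ℤ) (x : ℕ) :
    root n i f x = if label n x = i then 2 * f x - neighborSum n f x else 0 := rfl

theorem root_apply_of_ne {i : ZMod n} (f : ℕ → ℤ) {x : ℕ} (h : label n x ≠ i) :
    root n i f x = 0 := by
  simp [root_apply, h]

theorem one_ne_zero_of_three_le (hn : 3 ≤ n) : (1 : ZMod n) ≠ 0 := by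
  have : Fact (1 < n) := ⟨by omega⟩
  exact one_ne_zero

theorem two_ne_zero_of_three_le (hn : 3 ≤ n) : (2 : ZMod n) ≠ 0 := by
  intro h
  have h' : ((2 : ℕ) : ZMod n) = 0 := by exact_mod_cast h
  rw [ZMod.natCast_eq_zero_iff] at h'
  have := Nat.le_of_dvd (by norm_num) h'
  omega

theorem root_root_add_one (hn : 3 ≤ n) {x : ℕ} {i : ZMod n} (h : label n x = i) (f : ℕ → ℤ) :
    root n i (root n (i + 1) f) x = -root n (i + 1) f (up n x) := by
  have h1 := one_ne_zero_of_three_le hn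
  have h2 := two_ne_zero_of_three_le hn
  have hs : label n x - 1 ≠ i + 1 := by
    rw [h]
    intro h'
    exact h2 (by linear_combination -h')
  rw [root_apply, if_pos h, neighborSum, root_apply_of_ne f (x := x) (by rw [h]; simpa using h1),
    root_apply_of_ne f (x := x + 1) (by rwa [label_succ]),
    root_apply_of_ne f (x := branch n x) (by rwa [label_branch hn])]
  simp

theorem root_add_one_root (hn : 3 ≤ n) {x : ℕ} {i : ZMod n} (h : label n x = i + 1)
    (f : ℕ → ℤ) :
    root n (i + 1) (root n i f) x =
      -(root n i f (x + 1) + if label n x = 0 then root n i f (branch n x) else 0) := by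
  have h1 := one_ne_zero_of_three_le hn
  have h2 := two_ne_zero_of_three_le hn
  rw [root_apply, if_pos h, neighborSum, root_apply_of_ne f (x := x) (by rw [h]; simpa using h1),
    root_apply_of_ne f (x := up n x) (by
      rw [label_up hn, h]
      intro h'
      exact h2 (by linear_combination h'))]
  ring

theorem root_mul_self (hn : 3 ≤ n) (i : ZMod n) : root n i * root n i = 2 * root n i := by
  have h1 := one_ne_zero_of_three_le hn
  ext1 f
  funext x
  rw [two_mul]
  simp only [Module.End.mul_apply, LinearMap.add_apply, Pi.add_apply]
  by_cases h : label n x = i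
  · have hu : label n (up n x) ≠ i := by
      rw [label_up hn, h]
      simpa using h1
    have hs : label n x - 1 ≠ i := by
      rw [h]
      simpa using h1
    rw [root_apply i (root n i f), if_pos h, neighborSum, root_apply_of_ne f hu,
      root_apply_of_ne f (x := x + 1) (by rwa [label_succ]),
      root_apply_of_ne f (x := branch n x) (by rwa [label_branch hn])]
    simp
    ring
  · simp [root_apply_of_ne _ h]

theorem root_mul_eq_zero (hn : 3 ≤ n) {i j : ZMod n} (hij : i ≠ j) (h₁ : j ≠ i + 1)
    (h₂ : i ≠ j + 1) : root n i * root n j = 0 := by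
  ext1 f
  funext x
  simp only [Module.End.mul_apply]
  by_cases h : label n x = i
  · have hs : label n x - 1 ≠ j := by
      rw [h]
      intro h'
      exact h₂ (by rw [← h']; ring)
    rw [root_apply, if_pos h, neighborSum, root_apply_of_ne f (x := x) (by rwa [h]),
      root_apply_of_ne f (x := up n x) (by rw [label_up hn, h]; exact h₁.symm),
      root_apply_of_ne f (x := x + 1) (by rwa [label_succ]),
      root_apply_of_ne f (x := branch n x) (by rwa [label_branch hn])]
    simp
  · simp [root_apply_of_ne _ h]

theorem root_mul_succ_mul (hn : 3 ≤ n) {i : ZMod n} (hi : i ≠ -1) :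
    root n i * root n (i + 1) * root n i = root n i := by
  ext1 f
  funext x
  simp only [Module.End.mul_apply]
  by_cases h : label n x = i
  · have hx : label n (up n x) = i + 1 := by rw [label_up hn, h]
    have h0 : ¬ label n (up n x) = 0 := by
      rw [hx]
      intro h'
      exact hi (eq_neg_of_add_eq_zero_left h')
    rw [root_root_add_one hn h, root_add_one_root hn hx, if_neg h0, up_add_one (by rwa [h])]
    ring
  · simp [root_apply_of_ne _ h]

theorem root_succ_mul_mul (hn : 3 ≤ n) {i : ZMod n} (hi : i ≠ -1) :
    root n (i + 1) * root n i * root n (i + 1) = root n (i + 1) := by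
  ext1 f
  funext x
  simp only [Module.End.mul_apply]
  by_cases h : label n x = i + 1
  · have h0 : ¬ label n x = 0 := by
      rw [h]
      intro h'
      exact hi (eq_neg_of_add_eq_zero_left h')
    rw [root_add_one_root hn h, if_neg h0,
      root_root_add_one hn (by rw [label_succ, h]; ring), up_succ]
    ring
  · simp [root_apply_of_ne _ h]

theorem root_zero_mul_mul (hn : 3 ≤ n) :
    root n 0 * root n (-1) * root n 0 = 2 * root n 0 := by
  ext1 f
  funext x
  rw [two_mul]
  simp only [Module.End.mul_apply, LinearMap.add_apply, Pi.add_apply]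
  by_cases h : label n x = 0
  · have e : (0 : ZMod n) = -1 + 1 := by ring
    have key := root_add_one_root hn (x := x) (i := -1) (by rw [h]; ring) (root n 0 f)
    have key' : ∀ y, label n y = -1 → root n (-1) (root n 0 f) y = - root n 0 f (up n y) := by
      intro y hy
      have := root_root_add_one hn hy f
      rwa [← e] at this
    rw [← e, if_pos h, key' _ (by rw [label_succ, h]; ring),
      key' _ (by rw [label_branch hn, h]; ring), up_succ, up_branch] at key
    rw [key]
    ring
  · simp [root_apply_of_ne _ h]

/-- The action of the generator `i` on functions on the path. -/
def reflection (n : ℕ) (i : ZMod n) : Module.End ℤ (ℕ → ℤ) := 1 - root n i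

theorem reflection_apply (i : ZMod n) (f : ℕ → ℤ) (x : ℕ) :
    reflection n i f x = if label n x = i then neighborSum n f x - f x else f x := by
  simp only [reflection, LinearMap.sub_apply, Module.End.one_apply, Pi.sub_apply, root_apply]
  split_ifs <;> ring

section BraidRelations

variable {R : Type*} [Ring R] {a b : R}

theorem one_sub_mul_self (ha : a * a = 2 * a) : (1 - a) * (1 - a) = 1 := by
  have : (1 - a) * (1 - a) = 1 - 2 * a + a * a := by noncomm_ring
  rw [this, ha]
  noncomm_ring

theorem one_sub_mul_one_sub_pow_two (ha : a * a = 2 * a) (hb : b * b = 2 * b)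
    (hab : a * b = 0) (hba : b * a = 0) : ((1 - a) * (1 - b)) ^ 2 = 1 := by
  have hc : (1 - a) * (1 - b) = (1 - b) * (1 - a) := by
    simp only [mul_sub, sub_mul, hab, hba]
    noncomm_ring
  rw [((show Commute (1 - a) (1 - b) from hc)).mul_pow, pow_two, pow_two, one_sub_mul_self ha,
    one_sub_mul_self hb, one_mul]

theorem one_sub_mul_one_sub_pow_three (ha : a * a = 2 * a) (hb : b * b = 2 * b)
    (haba : a * b * a = a) (hbab : b * a * b = b) : ((1 - a) * (1 - b)) ^ 3 = 1 := by
  have h : (1 - a) * (1 - b) * (1 - a) = (1 - b) * (1 - a) * (1 - b) := by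
    have h₁ : (1 - a) * (1 - b) * (1 - a) =
        1 - 2 * a - b + a * b + b * a + a * a - a * b * a := by noncomm_ring
    have h₂ : (1 - b) * (1 - a) * (1 - b) =
        1 - 2 * b - a + a * b + b * a + b * b - b * a * b := by noncomm_ring
    rw [h₁, h₂, ha, hb, haba, hbab]
    noncomm_ring
  calc ((1 - a) * (1 - b)) ^ 3
      = (1 - a) * (1 - b) * (1 - a) * ((1 - b) * (1 - a) * (1 - b)) := by
        simp only [pow_succ, pow_zero, one_mul, mul_assoc]
    _ = (1 - a) * (1 - b) * ((1 - a) * (1 - a)) * (1 - b) * (1 - a) := by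
        rw [← h]
        simp only [mul_assoc]
    _ = (1 - a) * ((1 - b) * (1 - b)) * (1 - a) := by
        rw [one_sub_mul_self ha]
        simp only [mul_assoc, one_mul]
    _ = 1 := by
        rw [one_sub_mul_self hb, mul_one, one_sub_mul_self ha]

theorem one_sub_mul_one_sub_pow_four (ha : a * a = 2 * a) (hb : b * b = 2 * b)
    (haba : a * b * a = 2 * a) : ((1 - a) * (1 - b)) ^ 4 = 1 := by
  have hA := one_sub_mul_self ha
  have hB := one_sub_mul_self hb
  have h : (1 - a) * (1 - b) * (1 - a) * (1 - b) = (1 - b) * (1 - a) * (1 - b) * (1 - a) := by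
    have h₃ : (1 - a) * (1 - b) * (1 - a) = 1 - b + a * b + b * a - 2 * a := by
      have : (1 - a) * (1 - b) * (1 - a) =
        1 - 2 * a - b + a * b + b * a + a * a - a * b * a := by noncomm_ring
      rw [this, ha, haba]
      noncomm_ring
    have h₄ : (1 - a) * (1 - b) * (1 - a) * (1 - b) =
        1 - 2 * b + b * b - 2 * a + a * b + 2 * (a * b) + b * a - a * (b * b) - b * a * b := by
      rw [h₃]
      noncomm_ring
    have h₅ : (1 - b) * (1 - a) * (1 - b) * (1 - a) =
        1 - 2 * b + b * b - 2 * a + a * b + b * a + 2 * (b * a) - b * b * a - b * a * b := by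
      rw [mul_assoc, mul_assoc, ← mul_assoc (1 - a), h₃]
      noncomm_ring
    rw [h₄, h₅, hb]
    noncomm_ring
  calc ((1 - a) * (1 - b)) ^ 4
      = (1 - a) * (1 - b) * (1 - a) * (1 - b) * ((1 - a) * (1 - b) * (1 - a) * (1 - b)) := by
        simp only [pow_succ, pow_zero, one_mul, mul_assoc]
    _ = (1 - a) * (1 - b) * (1 - a) * ((1 - b) * (1 - b)) * (1 - a) * (1 - b) * (1 - a) := by
        rw [h]
        nth_rw 1 [← h]
        simp only [mul_assoc]
    _ = (1 - a) * (1 - b) * ((1 - a) * (1 - a)) * (1 - b) * (1 - a) := by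
        rw [hB]
        simp only [mul_assoc, one_mul]
    _ = (1 - a) * ((1 - b) * (1 - b)) * (1 - a) := by
        rw [hA]
        simp only [mul_assoc, one_mul]
    _ = 1 := by
        rw [hB, mul_one, hA]

end BraidRelations

theorem isLiftable_reflection (hn : 3 ≤ n) {M : CoxeterMatrix (ZMod n)} (h4 : M (-1) 0 = 4)
    (h3 : ∀ i : ZMod n, i ≠ -1 → M i (i + 1) = 3)
    (h2 : ∀ i j : ZMod n, i ≠ j → j ≠ i + 1 → i ≠ j + 1 → M i j = 2) :
    M.IsLiftable (reflection n) := by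
  have pow_rev : ∀ {i j : ZMod n} {m : ℕ}, (reflection n i * reflection n j) ^ m = 1 →
      (reflection n j * reflection n i) ^ m = 1 := by
    intro i j m h
    have hj : reflection n j * reflection n j = 1 := one_sub_mul_self (root_mul_self hn j)
    calc (reflection n j * reflection n i) ^ m
        = (reflection n j * reflection n i) ^ m * (reflection n j * reflection n j) := by
          rw [hj, mul_one]
      _ = reflection n j * (reflection n i * reflection n j) ^ m * reflection n j := by
          rw [← mul_assoc, (show SemiconjBy (reflection n j) (reflection n i * reflection n j)
            (reflection n j * reflection n i) from (mul_assoc _ _ _).symm).pow_right m |>.eq]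
      _ = 1 := by rw [h, mul_one, hj]
  have succ_pow : ∀ i : ZMod n,
      (reflection n i * reflection n (i + 1)) ^ M i (i + 1) = 1 := by
    intro i
    by_cases hi : i = -1
    · subst hi
      rw [neg_add_cancel, h4]
      exact pow_rev (one_sub_mul_one_sub_pow_four (root_mul_self hn _) (root_mul_self hn _)
        (root_zero_mul_mul hn))
    · rw [h3 i hi]
      exact one_sub_mul_one_sub_pow_three (root_mul_self hn _) (root_mul_self hn _)
        (root_mul_succ_mul hn hi) (root_succ_mul_mul hn hi)
  intro i j
  by_cases hij : i = j
  · subst hij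
    rw [M.diagonal, pow_one]
    exact one_sub_mul_self (root_mul_self hn i)
  by_cases h₁ : j = i + 1
  · subst h₁
    exact succ_pow i
  by_cases h₂ : i = j + 1
  · subst h₂
    rw [M.symmetric]
    exact pow_rev (succ_pow j)
  rw [h2 i j hij h₁ h₂]
  exact one_sub_mul_one_sub_pow_two (root_mul_self hn _) (root_mul_self hn _)
    (root_mul_eq_zero hn hij h₁ h₂) (root_mul_eq_zero hn (Ne.symm hij) h₂ h₁)

/-- The action of a word on functions on the path. -/
def wordAction (n : ℕ) (ω : List (ZMod n)) : Module.End ℤ (ℕ → ℤ) :=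
  (ω.map (reflection n)).prod

theorem wordAction_cons (i : ZMod n) (ω : List (ZMod n)) (f : ℕ → ℤ) :
    wordAction n (i :: ω) f = reflection n i (wordAction n ω f) := by
  simp [wordAction]

theorem wordAction_eq_of_wordProd_eq (hn : 3 ≤ n) {W : Type*} [Group W]
    {M : CoxeterMatrix (ZMod n)} (cs : CoxeterSystem M W) (h4 : M (-1) 0 = 4)
    (h3 : ∀ i : ZMod n, i ≠ -1 → M i (i + 1) = 3)
    (h2 : ∀ i j : ZMod n, i ≠ j → j ≠ i + 1 → i ≠ j + 1 → M i j = 2) {ω η : List (ZMod n)}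
    (h : cs.wordProd ω = cs.wordProd η) : wordAction n ω = wordAction n η := by
  have key : ∀ ω : List (ZMod n),
      cs.lift ⟨reflection n, isLiftable_reflection hn h4 h3 h2⟩ (cs.wordProd ω) =
        wordAction n ω := by
    intro ω
    simp only [CoxeterSystem.wordProd, map_list_prod, List.map_map, wordAction]
    congr 2
    funext i
    simp
  rw [← key, ← key, h]

/-- A lower bound for the distance from the vertex `1`. -/
def depth (n x : ℕ) : ℕ :=
  if x = 1 then 0 else if 2 * n - 1 ≤ x then x + 3 - 2 * n else if x = 2 * n - 2 then 2 else 1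

theorem depth_le_up (hn : 3 ≤ n) (x : ℕ) : depth n x ≤ depth n (up n x) + 1 := by
  unfold depth up
  grind

theorem depth_le_succ (hn : 3 ≤ n) (x : ℕ) : depth n x ≤ depth n (x + 1) + 1 := by
  unfold depth
  grind

theorem depth_le_branch (hn : 3 ≤ n) (x : ℕ) : depth n x ≤ depth n (branch n x) + 1 := by
  unfold depth branch
  grind

/-- The indicator function of the vertex `1`. -/
def start : ℕ → ℤ := Pi.single 1 1

theorem wordAction_start_eq_zero (hn : 3 ≤ n) (ω : List (ZMod n)) (x : ℕ)
    (h : ω.length < depth n x) : wordAction n ω start x = 0 := by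
  induction ω generalizing x with
  | nil =>
    have : x ≠ 1 := by
      rintro rfl
      simp [depth] at h
    simp [wordAction, start, this]
  | cons i ω ih =>
    rw [List.length_cons] at h
    have hx := ih x (by omega)
    have hu := ih (up n x) (by have := depth_le_up hn x; omega)
    have hs := ih (x + 1) (by have := depth_le_succ hn x; omega)
    have hb := ih (branch n x) (by have := depth_le_branch hn x; omega)
    rw [wordAction_cons, reflection_apply, neighborSum, hx, hu, hs, hb]
    simp

/-- The vertices of the geodesic starting at the neighbour `0` of `1`. -/
def geodesic (n : ℕ) : ℕ → ℕ
  | 0 => 0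
  | j + 1 => 2 * n - 1 + j

/-- The labels along the geodesic, from its end to its start. -/
def geodesicWord (n : ℕ) : ℕ → List (ZMod n)
  | 0 => [-1]
  | j + 1 => -(j : ZMod n) :: geodesicWord n j

theorem length_geodesicWord (j : ℕ) : (geodesicWord n j).length = j + 1 := by
  induction j with
  | zero => rfl
  | succ j ih => simp [geodesicWord, ih]

theorem depth_geodesic (hn : 3 ≤ n) (j : ℕ) : depth n (geodesic n j) = j + 1 := by
  cases j with
  | zero => simp only [depth, geodesic]; grind
  | succ j => simp only [depth, geodesic]; grind

theorem label_geodesic_succ (hn : 3 ≤ n) (j : ℕ) :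
    label n (geodesic n (j + 1)) = -(j : ZMod n) := by
  simp only [label, geodesic]
  rw [Nat.cast_add, Nat.cast_sub (by omega)]
  push_cast
  rw [ZMod.natCast_self]
  ring

theorem wordAction_cons_geodesic_zero (hn : 3 ≤ n) (i : ZMod n) :
    wordAction n [i] start (geodesic n 0) = if i = -1 then 1 else 0 := by
  have h0 : label n 0 = -1 := by simp [label]
  have h1 : (-1 : ZMod n) ≠ 0 := neg_ne_zero.mpr (one_ne_zero_of_three_le hn)
  have hu : up n 0 ≠ 1 := by simp only [up, if_true]; omega
  simp [wordAction, reflection_apply, geodesic, h0, neighborSum, h1, start, hu, eq_comm]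

theorem wordAction_cons_geodesic_succ (hn : 3 ≤ n) (j : ℕ) (i : ZMod n) (ω : List (ZMod n))
    (hω : ω.length = j + 1) :
    wordAction n (i :: ω) start (geodesic n (j + 1)) =
      if i = -(j : ZMod n) then wordAction n ω start (geodesic n j) else 0 := by
  have zero : ∀ y, j + 1 < depth n y → wordAction n ω start y = 0 :=
    fun y hy => wordAction_start_eq_zero hn ω y (by omega)
  rw [wordAction_cons, reflection_apply, label_geodesic_succ hn,
    zero (geodesic n (j + 1)) (by rw [depth_geodesic hn]; omega), neighborSum,
    label_geodesic_succ hn, zero (geodesic n (j + 1) + 1) (by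
      simp only [geodesic, depth]; grind), sub_zero, add_zero]
  by_cases hi : i = -(j : ZMod n)
  · rw [if_pos hi.symm, if_pos hi]
    cases j with
    | zero =>
      have hu : up n (geodesic n 1) = 2 * n - 2 := by
        simp only [up, geodesic]; grind
      rw [hu, zero (2 * n - 2) (by simp only [depth]; grind)]
      simp [geodesic, branch]
    | succ j =>
      have hu : up n (geodesic n (j + 1 + 1)) = geodesic n (j + 1) := by
        simp only [up, geodesic]; grind
      rw [hu, zero (branch n (geodesic n (j + 1 + 1))) (by
        simp only [geodesic, depth, branch]; grind)]
      simp
  · rw [if_neg (Ne.symm hi), if_neg hi]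

theorem wordAction_geodesic (hn : 3 ≤ n) (j : ℕ) (ω : List (ZMod n)) (hω : ω.length = j + 1) :
    wordAction n ω start (geodesic n j) = if ω = geodesicWord n j then 1 else 0 := by
  induction j generalizing ω with
  | zero =>
    obtain ⟨i, rfl⟩ := List.length_eq_one_iff.mp hω
    rw [wordAction_cons_geodesic_zero hn]
    simp [geodesicWord]
  | succ j ih =>
    obtain ⟨i, ω, rfl⟩ := List.exists_cons_of_length_eq_add_one hω
    rw [List.length_cons, add_left_inj] at hω
    rw [wordAction_cons_geodesic_succ hn j i ω hω, ih ω hω]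
    simp only [geodesicWord, List.cons.injEq]
    split_ifs <;> simp_all

end CyclePath

/-- The word `ω` is the unique shortest word representing its product. -/
def IsUniquelyReduced {B W : Type*} [Group W] {M : CoxeterMatrix B} (cs : CoxeterSystem M W)
    (ω : List B) : Prop :=
  ∀ η, cs.wordProd η = cs.wordProd ω → ω.length ≤ η.length ∧ (η.length = ω.length → η = ω)

namespace IsUniquelyReduced

variable {B W : Type*} [Group W] {M : CoxeterMatrix B} {cs : CoxeterSystem M W} {ω η : List B}

theorem isReduced (h : IsUniquelyReduced cs ω) : cs.IsReduced ω := by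
  obtain ⟨η, hη, hη'⟩ := cs.exists_isReduced (cs.wordProd ω)
  refine le_antisymm (cs.length_wordProd_le ω) ?_
  rw [hη', hη.eq]
  exact (h η hη'.symm).1

theorem eq_of_isReducedExprOf (h : IsUniquelyReduced cs ω)
    (hη : IsReducedExprOf cs η (cs.wordProd ω)) : η = ω :=
  (h η hη.2).2 (by rw [← hη.1.eq, hη.2, h.isReduced.eq])

theorem isReducedExprOf (h : IsUniquelyReduced cs ω) :
    IsReducedExprOf cs ω (cs.wordProd ω) :=
  ⟨h.isReduced, rfl⟩

theorem of_append (h : IsUniquelyReduced cs (ω ++ η)) : IsUniquelyReduced cs ω := by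
  intro ζ hζ
  have := h (ζ ++ η) (by rw [cs.wordProd_append, cs.wordProd_append, hζ])
  simpa using this

theorem isPrefix_of_weakLE (h : IsUniquelyReduced cs η) (hω : cs.IsReduced ω)
    (hle : weakLE cs (cs.wordProd ω) (cs.wordProd η)) : ω <+: η := by
  obtain ⟨ζ, hζ, hζ'⟩ := cs.exists_isReduced ((cs.wordProd ω)⁻¹ * cs.wordProd η)
  refine ⟨ζ, (h (ω ++ ζ) ?_).2 ?_⟩
  · rw [cs.wordProd_append, ← hζ', mul_inv_cancel_left]
  · rw [List.length_append, ← hω.eq, ← hζ.eq, ← hζ', ← h.isReduced.eq]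
    exact hle

end IsUniquelyReduced

namespace CyclePath

variable {n : ℕ}

/-- The word `s₂ s₃ ⋯ sₙ s₁`. -/
def cycleWord (n : ℕ) : List (ZMod n) := (List.range n).map fun k => ((k + 1 : ℕ) : ZMod n)

theorem geodesicWord_add (j m : ℕ) :
    geodesicWord n (j + m) =
      (List.range m).map (fun k => -((j + m - 1 - k : ℕ) : ZMod n)) ++ geodesicWord n j := by
  induction m with
  | zero => simp
  | succ m ih =>
    rw [← add_assoc, geodesicWord, ih, List.range_succ_eq_map, List.map_cons, List.map_map,
      List.cons_append]
    congr 3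
    funext k
    simp only [Function.comp_apply]
    congr 2
    omega

theorem geodesicWord_succ_mul (k : ℕ) :
    geodesicWord n ((k + 1) * n) = cycleWord n ++ geodesicWord n (k * n) := by
  rw [Nat.succ_mul, geodesicWord_add, cycleWord]
  congr 1
  refine List.map_congr_left fun i hi => ?_
  rw [List.mem_range] at hi
  rw [neg_eq_iff_add_eq_zero, ← Nat.cast_add, ZMod.natCast_eq_zero_iff]
  exact ⟨k + 1, by rw [mul_add, mul_comm n k]; omega⟩

theorem isUniquelyReduced_geodesicWord (hn : 3 ≤ n) {W : Type*} [Group W]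
    {M : CoxeterMatrix (ZMod n)} (cs : CoxeterSystem M W) (h4 : M (-1) 0 = 4)
    (h3 : ∀ i : ZMod n, i ≠ -1 → M i (i + 1) = 3)
    (h2 : ∀ i j : ZMod n, i ≠ j → j ≠ i + 1 → i ≠ j + 1 → M i j = 2) (j : ℕ) :
    IsUniquelyReduced cs (geodesicWord n j) := by
  intro η hη
  have hw : wordAction n η start (geodesic n j) = 1 := by
    rw [wordAction_eq_of_wordProd_eq hn cs h4 h3 h2 hη,
      wordAction_geodesic hn j _ (length_geodesicWord j), if_pos rfl]
  rw [length_geodesicWord]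
  constructor
  · by_contra! hlt
    rw [wordAction_start_eq_zero hn η _ (by rwa [depth_geodesic hn])] at hw
    exact zero_ne_one hw
  · intro hlen
    rw [wordAction_geodesic hn j η hlen] at hw
    by_contra hne
    rw [if_neg hne] at hw
    exact zero_ne_one hw

theorem wordProd_geodesicWord_mul {W : Type*} [Group W] {M : CoxeterMatrix (ZMod n)}
    (cs : CoxeterSystem M W) (k : ℕ) :
    cs.wordProd (geodesicWord n (k * n)) = cs.wordProd (cycleWord n) ^ k * cs.simple (-1) := by
  induction k with
  | zero => simp [geodesicWord]
  | succ k ih => rw [geodesicWord_succ_mul, cs.wordProd_append, ih, pow_succ', mul_assoc]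

theorem cycleWord_eq_cons (hn : 3 ≤ n) : ∃ ω, cycleWord n = 1 :: ω := by
  obtain ⟨m, rfl⟩ : ∃ m, n = m + 1 := ⟨n - 1, by omega⟩
  exact ⟨_, by rw [cycleWord, List.range_succ_eq_map, List.map_cons]; simp; rfl⟩

theorem not_singleton_isPrefix_cycleWord_append (hn : 3 ≤ n) (ω : List (ZMod n)) :
    ¬ [-1] <+: cycleWord n ++ ω := by
  obtain ⟨η, hη⟩ := cycleWord_eq_cons hn
  rw [hη]
  rintro ⟨ζ, hζ⟩
  rw [List.singleton_append, List.cons_append, List.cons.injEq] at hζ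
  exact two_ne_zero_of_three_le hn (by linear_combination -hζ.1)

theorem eq_of_geodesicWord_isPrefix (hn : 3 ≤ n) {j k : ℕ}
    (h : geodesicWord n (j * n) <+: geodesicWord n (k * n)) : j = k := by
  induction j generalizing k with
  | zero =>
    cases k with
    | zero => rfl
    | succ k =>
      rw [geodesicWord_succ_mul, zero_mul] at h
      exact absurd h (not_singleton_isPrefix_cycleWord_append hn _)
  | succ j ih =>
    cases k with
    | zero =>
      have := h.length_le
      rw [length_geodesicWord, length_geodesicWord, Nat.succ_mul] at this
      omega
    | succ k =>
      rw [geodesicWord_succ_mul, geodesicWord_succ_mul, List.prefix_append_right_inj] at h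
      rw [ih h]

theorem three_le_card_toFinset_cycleWord (hn : 3 ≤ n) : 3 ≤ (cycleWord n).toFinset.card := by
  have h1 := one_ne_zero_of_three_le hn
  have h2 := two_ne_zero_of_three_le hn
  have mem : ∀ k < n, ((k + 1 : ℕ) : ZMod n) ∈ (cycleWord n).toFinset := fun k hk =>
    List.mem_toFinset.mpr (List.mem_map_of_mem (List.mem_range.mpr hk))
  have sub : ({0, 1, -1} : Finset (ZMod n)) ⊆ (cycleWord n).toFinset := by
    intro i hi
    simp only [Finset.mem_insert, Finset.mem_singleton] at hi
    rcases hi with rfl | rfl | rfl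
    · have := mem (n - 1) (by omega)
      rwa [show n - 1 + 1 = n by omega, ZMod.natCast_self] at this
    · simpa using mem 0 (by omega)
    · have := mem (n - 2) (by omega)
      rwa [show n - 2 + 1 = n - 1 by omega, Nat.cast_sub (by omega), ZMod.natCast_self, zero_sub,
        Nat.cast_one] at this
  refine le_of_eq_of_le ?_ (Finset.card_le_card sub)
  have h3 : (1 : ZMod n) ≠ -1 := fun h => h2 (by linear_combination h)
  rw [Finset.card_eq_three.mpr ⟨0, 1, -1, h1.symm, (neg_ne_zero.mpr h1).symm, h3, rfl⟩]

end CyclePath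

open CyclePath in
/-- Let `(W,S)` be a Coxeter system whose diagram is a cycle
`s₁, s₂, …, sₙ, s₁` (generators indexed by `ZMod n`, with `s₁ = 0, …,
sₙ = n - 1 = -1`) with `m(s₁,sₙ) = 4`, all other consecutive labels equal to
`3`, and non-consecutive generators commuting.  Then `u = sₙ` and
`w = s₂s₃⋯sₙs₁` form a good pair, and `{wᵏu : k ∈ ℕ}` is an infinite
antichain in the right weak order. -/
theorem cycle_good_pair (n : ℕ) (hn : 3 ≤ n) {W : Type*} [Group W]
    {M : CoxeterMatrix (ZMod n)} (cs : CoxeterSystem M W)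
    (h4 : M (-1) 0 = 4)
    (h3 : ∀ i : ZMod n, i ≠ -1 → M i (i + 1) = 3)
    (h2 : ∀ i j : ZMod n, i ≠ j → j ≠ i + 1 → i ≠ j + 1 → M i j = 2) :
    letI u : W := cs.simple (-1)
    letI w : W := cs.wordProd ((List.range n).map (fun k => ((k + 1 : ℕ) : ZMod n)))
    cs.length u ≤ cs.length w ∧
    ¬ weakLE cs u w ∧
    (∀ ω : List (ZMod n), IsReducedExprOf cs ω w → 3 ≤ ω.toFinset.card) ∧
    (cs.length (w * u) = cs.length w + cs.length u ∧
      ∀ ω : List (ZMod n), IsReducedExprOf cs ω (w * u) →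
        ∃ ω₁ ω₂, ω = ω₁ ++ ω₂ ∧ IsReducedExprOf cs ω₁ w ∧ IsReducedExprOf cs ω₂ u) ∧
    (cs.length (w * w) = 2 * cs.length w ∧
      ∀ ω : List (ZMod n), IsReducedExprOf cs ω (w * w) →
        ∃ ω₁ ω₂, ω = ω₁ ++ ω₂ ∧ IsReducedExprOf cs ω₁ w ∧ IsReducedExprOf cs ω₂ w) ∧
    ((Set.range fun k : ℕ => w ^ k * u).Infinite ∧
      IsAntichain (weakLE cs) (Set.range fun k : ℕ => w ^ k * u)) := by
  have geo := isUniquelyReduced_geodesicWord hn cs h4 h3 h2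
  have prod_geo := wordProd_geodesicWord_mul cs
  have hww : IsUniquelyReduced cs (cycleWord n ++ cycleWord n) := by
    have := geo ((0 + 1 + 1) * n)
    rw [geodesicWord_succ_mul, geodesicWord_succ_mul, ← List.append_assoc] at this
    exact this.of_append
  have hw : IsUniquelyReduced cs (cycleWord n) := hww.of_append
  have hwu : IsUniquelyReduced cs (cycleWord n ++ [-1]) := by
    have := geo ((0 + 1) * n)
    rwa [geodesicWord_succ_mul, zero_mul] at this
  have hu : IsUniquelyReduced cs [-1] := geo 0
  have hwu_prod : cs.wordProd (cycleWord n ++ [-1]) =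
      cs.wordProd (cycleWord n) * cs.simple (-1) := by
    rw [cs.wordProd_append, cs.wordProd_singleton]
  have hlen : cs.length (cs.wordProd (cycleWord n)) = n := by
    rw [hw.isReduced.eq]
    simp [cycleWord]
  have length_geo : ∀ k, cs.length (cs.wordProd (cycleWord n) ^ k * cs.simple (-1)) =
      k * n + 1 := by
    intro k
    rw [← prod_geo, (geo _).isReduced.eq, length_geodesicWord]
  change cs.length (cs.simple (-1)) ≤ cs.length (cs.wordProd (cycleWord n)) ∧ _
  refine ⟨?_, ?_, ?_, ⟨?_, ?_⟩, ⟨?_, ?_⟩, ?_, ?_⟩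
  · rw [cs.length_simple, hlen]
    omega
  · intro hle
    rw [← cs.wordProd_singleton] at hle
    have := hw.isPrefix_of_weakLE hu.isReduced hle
    rw [← List.append_nil (cycleWord n)] at this
    exact not_singleton_isPrefix_cycleWord_append hn [] this
  · intro ω hω
    rw [hw.eq_of_isReducedExprOf hω]
    exact three_le_card_toFinset_cycleWord hn
  · change cs.length (cs.wordProd (cycleWord n) * _) = cs.length (cs.wordProd (cycleWord n)) + _
    rw [← hwu_prod, hwu.isReduced.eq, cs.length_simple, List.length_append, hw.isReduced.eq,
      List.length_singleton]
  · intro ω hω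
    refine ⟨cycleWord n, [-1], hwu.eq_of_isReducedExprOf (hwu_prod ▸ hω), hw.isReducedExprOf, ?_⟩
    simpa using hu.isReducedExprOf
  · change cs.length (cs.wordProd (cycleWord n) * cs.wordProd (cycleWord n)) =
      2 * cs.length (cs.wordProd (cycleWord n))
    rw [← cs.wordProd_append, hww.isReduced.eq, List.length_append, hw.isReduced.eq, two_mul]
  · intro ω hω
    exact ⟨cycleWord n, cycleWord n,
      hww.eq_of_isReducedExprOf ((cs.wordProd_append (cycleWord n) (cycleWord n)).symm ▸ hω),
      hw.isReducedExprOf, hw.isReducedExprOf⟩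
  · refine Set.infinite_range_of_injective fun j k hjk => ?_
    have := congrArg cs.length hjk
    change cs.length (cs.wordProd (cycleWord n) ^ j * _) =
      cs.length (cs.wordProd (cycleWord n) ^ k * _) at this
    rw [length_geo, length_geo, add_left_inj] at this
    exact Nat.eq_of_mul_eq_mul_right (by omega) this
  · rintro _ ⟨j, rfl⟩ _ ⟨k, rfl⟩ hne hle
    refine hne ?_
    change weakLE cs (cs.wordProd (cycleWord n) ^ j * _)
      (cs.wordProd (cycleWord n) ^ k * _) at hle
    rw [← prod_geo, ← prod_geo] at hle
    rw [eq_of_geodesicWord_isPrefix hn ((geo _).isPrefix_of_weakLE (geo _).isReduced hle)]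
end
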